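/- arXiv:1510.00457 — 7 statements merged into one kernel-verified Lean document; each statement's English description precedes it below -/
import Mathlib

section
/- Let G be a finitely presentable group with def(G) ≤ 0 and let H be a subgroup of finite index in G. Then H is finitely presentable and def(H) ≥ [G:H]·def(G) + 1 − [G:H]. Concretely: if G has a finite presentation with g generators and r relations and [G:H] = n, then H has a finite presentation with g' generators and r' relations satisfying g' − r' ≥ n(g − r) + 1 − n. -/
/-- `G` admits a finite presentation with `g` generators and `r` relations:
`G` is the quotient of the free group on `g` generators by the normal closure
of a family of `r` relators. -/
def HasPresentation (G : Type*) [Group G] (g r : ℕ) : Prop :=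
  ∃ rels : Fin r → FreeGroup (Fin g),
    Nonempty (G ≃* FreeGroup (Fin g) ⧸ Subgroup.normalClosure (Set.range rels))

/-- `G` is poly-`ℤ` of Hirsch length `n`: there is a chain of subgroups
`⊥ = P 0 ≤ P 1 ≤ ⋯ ≤ P n = ⊤` with each `P i` normal in `P (i+1)` and with
infinite cyclic quotients. -/
def IsPolyZ (G : Type*) [Group G] (n : ℕ) : Prop :=
  ∃ c : Fin (n + 1) → Subgroup G,
    c 0 = ⊥ ∧ c (Fin.last n) = ⊤ ∧
      ∀ i : Fin n, c i.castSucc ≤ c i.succ ∧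
        ∃ _ : ((c i.castSucc).subgroupOf (c i.succ)).Normal,
          Nonempty ((↥(c i.succ) ⧸ (c i.castSucc).subgroupOf (c i.succ)) ≃* Multiplicative ℤ)

/-- `G` is virtually poly-`ℤ` of Hirsch length `n`. -/
def IsVirtuallyPolyZ (G : Type*) [Group G] (n : ℕ) : Prop :=
  ∃ H : Subgroup G, H.FiniteIndex ∧ IsPolyZ H n

/-- `G` can be generated by `s` elements. -/
def GeneratedByN (G : Type*) [Group G] (s : ℕ) : Prop :=
  ∃ f : Fin s → G, Subgroup.closure (Set.range f) = ⊤

/-- A basis of a finitely generated free group is finite. -/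
theorem FreeGroup.finite_of_fg (α : Type*) [Group.FG (FreeGroup α)] : Finite α := by
  have : AddGroup.FG (FreeAbelianGroup α) :=
    have : Group.FG (Abelianization (FreeGroup α)) :=
      Group.fg_of_surjective (f := Abelianization.of) QuotientGroup.mk_surjective
    inferInstanceAs (AddGroup.FG (Additive (Abelianization (FreeGroup α))))
  have : Module.Finite ℤ (FreeAbelianGroup α) := Module.Finite.iff_addGroup_fg.mpr this
  exact Module.Finite.finite_basis (FreeAbelianGroup.basis α)

section CrossedHom

variable (𝕜 F X : Type*) [Field 𝕜] [Group F] [MulAction F X]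

/-- Crossed homomorphisms from `F` to the module of functions `X → 𝕜`. -/
def crossedHom : Submodule 𝕜 (F → X → 𝕜) where
  carrier := {c | ∀ a b x, c (a * b) x = c a x + c b (a⁻¹ • x)}
  zero_mem' := by simp
  add_mem' := by
    intro c d hc hd a b x
    simp only [Pi.add_apply, hc a b x, hd a b x]
    ring
  smul_mem' := by
    intro t c hc a b x
    simp only [Pi.smul_apply, hc a b x, smul_add]

variable {𝕜 F X}

theorem crossedHom.map_one (c : crossedHom 𝕜 F X) (x : X) : c.1 1 x = 0 := by
  simpa using c.2 1 1 x

/-- A crossed homomorphism on a free group may be prescribed on the generators. -/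
theorem exists_crossedHom_freeGroup {ι : Type*} [MulAction (FreeGroup ι) X] (f : ι → X → 𝕜) :
    ∃ c : crossedHom 𝕜 (FreeGroup ι) X, ∀ i, c.1 (FreeGroup.of i) = f i := by
  let φ : FreeGroup ι →* (X → Multiplicative 𝕜) ⋊[mulAutArrow] FreeGroup ι :=
    FreeGroup.lift fun i => ⟨fun x => Multiplicative.ofAdd (f i x), FreeGroup.of i⟩
  have hφ : ∀ w, (φ w).right = w := fun w =>
    DFunLike.congr_fun (show SemidirectProduct.rightHom.comp φ = MonoidHom.id _ by
      ext i; simp [φ]) w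
  refine ⟨⟨fun w x => Multiplicative.toAdd ((φ w).left x), ?_⟩, ?_⟩
  · intro a b x
    simp only [map_mul, SemidirectProduct.mul_left, hφ, Pi.mul_apply, toAdd_mul]
    rfl
  · intro i
    funext x
    simp [φ]

/-- A crossed homomorphism vanishing on the stabilizer of the base point, evaluated at this
point, is principal. -/
theorem crossedHom_quotient_principal {K : Subgroup F} (c : crossedHom 𝕜 F (F ⧸ K))
    (hc : ∀ k ∈ K, c.1 k ((1 : F) : F ⧸ K) = 0) :
    ∃ u : F ⧸ K → 𝕜, ∀ w x, c.1 w x = u x - u (w⁻¹ • x) := by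
  have key : ∀ t k : F, k ∈ K → c.1 (t * k) (t : F ⧸ K) = c.1 t (t : F ⧸ K) := by
    intro t k hk
    have h : t⁻¹ • (t : F ⧸ K) = ((1 : F) : F ⧸ K) :=
      congr_arg _ (inv_mul_cancel t)
    rw [c.2 t k, h, hc k hk, add_zero]
  have hu : ∀ t : F, c.1 (t : F ⧸ K).out (t : F ⧸ K) = c.1 t (t : F ⧸ K) := by
    intro t
    obtain ⟨k, hk⟩ := QuotientGroup.mk_out_eq_mul K t
    rw [hk, key t k k.2]
  refine ⟨fun x => c.1 x.out x, fun w x => ?_⟩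
  obtain ⟨t, rfl⟩ := QuotientGroup.mk_surjective x
  have h := c.2 w (w⁻¹ * t) (t : F ⧸ K)
  rw [mul_inv_cancel_left] at h
  have e : w⁻¹ • (t : F ⧸ K) = ((w⁻¹ * t : F) : F ⧸ K) := rfl
  simp only [e] at h ⊢
  rw [hu, hu, h]
  ring

end CrossedHom

/-- Lower bound in the Schreier index formula. -/
theorem FreeGroup.schreier_index_le {ι Y : Type*} [Fintype ι] [Fintype Y]
    (K : Subgroup (FreeGroup ι)) [K.FiniteIndex] (b : Y → FreeGroup ι)
    (hb : Subgroup.closure (Set.range b) = K) :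
    K.index * Fintype.card ι + 1 ≤ Fintype.card Y + K.index := by
  classical
  let F := FreeGroup ι
  let X := F ⧸ K
  have : Fintype X := Fintype.ofFinite X
  have hX : Fintype.card X = K.index := by
    rw [Subgroup.index, Nat.card_eq_fintype_card]
  let x₀ : X := ((1 : F) : X)
  let ev : crossedHom ℚ F X →ₗ[ℚ] (ι → X → ℚ) :=
    { toFun := fun c i => c.1 (FreeGroup.of i)
      map_add' := fun _ _ => rfl
      map_smul' := fun _ _ => rfl }
  have hev : Function.Surjective ev := fun f =>
    let ⟨c, hc⟩ := exists_crossedHom_freeGroup f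
    ⟨c, funext hc⟩
  obtain ⟨s, hs⟩ := ev.exists_rightInverse_of_surjective (LinearMap.range_eq_top.mpr hev)
  let res : crossedHom ℚ F X →ₗ[ℚ] (Y → ℚ) :=
    { toFun := fun c y => c.1 (b y) x₀
      map_add' := fun _ _ => rfl
      map_smul' := fun _ _ => rfl }
  let D : (X → ℚ) →ₗ[ℚ] (ι → X → ℚ) :=
    { toFun := fun u i x => u x - u ((FreeGroup.of i : F)⁻¹ • x)
      map_add' := fun u v => by
        funext i x
        simp only [Pi.add_apply]
        ring
      map_smul' := fun t u => by
        funext i x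
        simp only [Pi.smul_apply, smul_sub, RingHom.id_apply] }
  have hfix : ∀ k ∈ K, k⁻¹ • x₀ = x₀ := by
    intro k hk
    change ((k⁻¹ * 1 : F) : X) = ((1 : F) : X)
    rw [QuotientGroup.eq]
    simpa using hk
  have hker : LinearMap.ker (res ∘ₗ s) ≤ LinearMap.range D := by
    intro f hf
    have hf0 : ∀ y, (s f).1 (b y) x₀ = 0 := fun y => congr_fun (LinearMap.mem_ker.mp hf) y
    have hK : ∀ k ∈ K, (s f).1 k x₀ = 0 := by
      intro k hk
      rw [← hb] at hk
      induction hk using Subgroup.closure_induction with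
      | mem x hx =>
        obtain ⟨y, rfl⟩ := hx
        exact hf0 y
      | one => exact crossedHom.map_one _ _
      | mul x y hx _ ihx ihy =>
        rw [(s f).2 x y, hfix x (hb ▸ hx), ihx, ihy, add_zero]
      | inv x hx ih =>
        have h := (s f).2 x x⁻¹ x₀
        rw [mul_inv_cancel, crossedHom.map_one, hfix x (hb ▸ hx), ih, zero_add] at h
        exact h.symm
    obtain ⟨u, hu⟩ := crossedHom_quotient_principal (s f) hK
    refine ⟨u, ?_⟩
    have hf' : ev (s f) = f := LinearMap.congr_fun hs f
    rw [← hf']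
    funext i x
    exact (hu _ _).symm
  have hD : 1 ≤ Module.finrank ℚ (LinearMap.ker D) := by
    rw [Nat.one_le_iff_ne_zero, ← Nat.pos_iff_ne_zero]
    have : Nontrivial (LinearMap.ker D) :=
      ⟨⟨⟨fun _ => 1, by
        rw [LinearMap.mem_ker]
        funext i x
        exact sub_self _⟩, 0, fun h =>
          one_ne_zero (congr_fun (congr_arg Subtype.val h) x₀)⟩⟩
    exact Module.finrank_pos
  have h1 := (res ∘ₗ s).finrank_range_add_finrank_ker
  have h2 := D.finrank_range_add_finrank_ker
  have h3 := Submodule.finrank_mono hker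
  have h4 := (LinearMap.range (res ∘ₗ s)).finrank_le
  rw [Module.finrank_pi] at h4 h2
  rw [Module.finrank_pi_fintype, Finset.sum_const, Module.finrank_pi, smul_eq_mul,
    Finset.card_univ, mul_comm] at h1
  rw [hX] at h1 h2
  omega

/-- The normal closure of a family, contained in a subgroup `K`, is the normal closure in `K` of
the conjugates of the family by a transversal of `K`. -/
theorem Subgroup.normalClosure_subgroupOf_eq {F ι : Type*} [Group F] (K : Subgroup F)
    (rel : ι → F) (s : ι × (F ⧸ K) → K)
    (hs : ∀ i x, (s (i, x) : F) = x.out⁻¹ * rel i * x.out) :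
    (normalClosure (Set.range rel)).subgroupOf K = normalClosure (Set.range s) := by
  apply le_antisymm
  · have h : normalClosure (Set.range rel) ≤ (normalClosure (Set.range s)).map K.subtype := by
      rw [normalClosure, closure_le]
      intro y hy
      obtain ⟨_, ⟨i, rfl⟩, hy⟩ := Group.mem_conjugatesOfSet_iff.mp hy
      obtain ⟨f, rfl⟩ := isConj_iff.mp hy
      obtain ⟨k, hk⟩ := QuotientGroup.mk_out_eq_mul K f⁻¹
      refine ⟨k * s (i, ((f⁻¹ : F) : F ⧸ K)) * k⁻¹, ?_, ?_⟩
      · exact normalClosure_normal.conj_mem _ (subset_normalClosure (Set.mem_range_self _)) k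
      · simp only [coe_subtype, coe_mul, hs, hk, coe_inv]
        group
    intro x hx
    obtain ⟨y, hy, hyx⟩ := h (mem_subgroupOf.mp hx)
    rwa [← Subtype.ext hyx]
  · apply normalClosure_le_normal
    rintro _ ⟨⟨i, x⟩, rfl⟩
    rw [SetLike.mem_coe, mem_subgroupOf, hs]
    simpa using normalClosure_normal.conj_mem _
      (subset_normalClosure (Set.mem_range_self i)) x.out⁻¹

theorem HasPresentation.of_surjective {Q H ι κ : Type*} [Group Q] [Group H] [Fintype ι]
    [Fintype κ] (e : FreeGroup ι ≃* Q) (f : Q →* H) (hf : Function.Surjective f) (s : κ → Q)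
    (hs : f.ker = Subgroup.normalClosure (Set.range s)) :
    HasPresentation H (Fintype.card ι) (Fintype.card κ) := by
  let e' : FreeGroup (Fin (Fintype.card ι)) ≃* Q :=
    (FreeGroup.freeGroupCongr (Fintype.equivFin ι).symm).trans e
  refine ⟨fun j => e'.symm (s ((Fintype.equivFin κ).symm j)), ⟨?_⟩⟩
  have hsurj : Function.Surjective (f.comp e'.toMonoidHom) := hf.comp e'.surjective
  refine (QuotientGroup.quotientKerEquivOfSurjective _ hsurj).symm.trans
    (QuotientGroup.quotientMulEquivOfEq ?_)
  have hr : Set.range (fun j => e'.symm (s ((Fintype.equivFin κ).symm j))) =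
      e'.symm '' Set.range s := by
    rw [← Set.range_comp, ← (Fintype.equivFin κ).symm.surjective.range_comp]
    rfl
  rw [hr, ← MonoidHom.comap_ker, hs]
  exact (Subgroup.comap_equiv_eq_map_symm' e' _).trans
    (Subgroup.map_normalClosure _ e'.symm.toMonoidHom e'.symm.surjective)

/-- If `G` is finitely presentable with `def G ≤ 0` and `H ≤ G` has finite index, then
`H` is finitely presentable and `def H ≥ [G:H]·def G + 1 − [G:H]`; concretely, from a
presentation of `G` with `g` generators and `r` relations one gets a presentation of `H`
with `g' - r' ≥ n(g - r) + 1 - n` where `n = [G:H]`. -/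
theorem deficiency_finite_index_subgroup (G : Type*) [Group G] (H : Subgroup G)
    (hfi : H.FiniteIndex)
    (hdef : ∀ g r : ℕ, HasPresentation G g r → (g : ℤ) - (r : ℤ) ≤ 0)
    (g r : ℕ) (hpres : HasPresentation G g r) :
    ∃ g' r' : ℕ, HasPresentation H g' r' ∧
      (H.index : ℤ) * ((g : ℤ) - (r : ℤ)) + 1 - (H.index : ℤ) ≤ (g' : ℤ) - (r' : ℤ) := by
  classical
  obtain ⟨rels, ⟨φ⟩⟩ := hpres
  let N := Subgroup.normalClosure (Set.range rels)
  let π : FreeGroup (Fin g) →* G := φ.symm.toMonoidHom.comp (QuotientGroup.mk' N)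
  have hπ : Function.Surjective π := φ.symm.surjective.comp (QuotientGroup.mk'_surjective N)
  have hπN : π.ker = N := by
    ext x
    simp [π]
  let K := H.comap π
  have hK : K.index = H.index := H.index_comap_of_surjective hπ
  have : K.FiniteIndex := ⟨hK ▸ hfi.index_ne_zero⟩
  obtain ⟨Y, ⟨b⟩⟩ := IsFreeGroup.nonempty_basis (G := K)
  have : Group.FG (FreeGroup Y) :=
    Group.fg_of_surjective (f := b.repr.toMonoidHom) b.repr.surjective
  have := FreeGroup.finite_of_fg Y
  have := Fintype.ofFinite Y
  have : Fintype (FreeGroup (Fin g) ⧸ K) := Fintype.ofFinite _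
  have hrel : ∀ p : Fin r × (FreeGroup (Fin g) ⧸ K),
      p.2.out⁻¹ * rels p.1 * p.2.out ∈ K := fun p => by
    have h : rels p.1 ∈ π.ker := hπN ▸ Subgroup.subset_normalClosure (Set.mem_range_self _)
    change π _ ∈ H
    simp [MonoidHom.mem_ker.mp h]
  have hker : (π.subgroupComap H).ker = Subgroup.normalClosure
      (Set.range fun p => (⟨_, hrel p⟩ : K)) := by
    rw [← Subgroup.normalClosure_subgroupOf_eq K rels _ fun _ _ => rfl]
    change _ = N.subgroupOf K
    rw [← hπN]
    ext x
    exact Subtype.ext_iff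
  refine ⟨_, _, HasPresentation.of_surjective b.repr.symm (π.subgroupComap H)
    (π.subgroupComap_surjective_of_surjective H hπ) _ hker, ?_⟩
  have hb : Subgroup.closure (Set.range fun y => (b y : FreeGroup (Fin g))) = K := by
    have h : Subgroup.closure (Set.range b) = ⊤ := by
      have h' := congr_arg (Subgroup.map b.repr.symm.toMonoidHom) (FreeGroup.closure_range_of Y)
      rw [MonoidHom.map_closure, ← Set.range_comp,
        Subgroup.map_top_of_surjective _ b.repr.symm.surjective] at h'
      exact h'
    have h' := congr_arg (Subgroup.map K.subtype) h
    rw [MonoidHom.map_closure, ← Set.range_comp, ← MonoidHom.range_eq_map, K.range_subtype] at h'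
    exact h'
  have hcard := FreeGroup.schreier_index_le K _ hb
  have hX : Fintype.card (FreeGroup (Fin g) ⧸ K) = H.index := by
    rw [← hK, Subgroup.index, Nat.card_eq_fintype_card]
  rw [hK, Fintype.card_fin] at hcard
  rw [Fintype.card_prod, Fintype.card_fin, hX]
  zify at hcard
  push_cast
  linarith
end

section
/- Let π = K ⋊_φ ℤ be a semidirect product, where K is a finitely presentable group which can be generated by s elements and φ : ℤ → Aut(K) is an action. Then π can be generated by s + 1 elements, and def(π) ≥ 1 + def(K) − s; concretely, if K has a finite presentation with g generators and r relations, then π has a finite presentation with g' generators and r' relations satisfying g' − r' ≥ 1 + (g − r) − s. -/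
open Multiplicative in
/-- If `K` is generated by `s` elements, then `K ⋊[φ] ℤ` is generated by `s + 1` elements. -/
theorem GeneratedByN.semidirectProduct_int {K : Type*} [Group K]
    (φ : Multiplicative ℤ →* MulAut K) {s : ℕ} (hgen : GeneratedByN K s) :
    GeneratedByN (K ⋊[φ] Multiplicative ℤ) (s + 1) := by
  obtain ⟨f, hf⟩ := hgen
  let c : Fin (s + 1) → K ⋊[φ] Multiplicative ℤ :=
    Fin.cons (SemidirectProduct.inr (ofAdd 1)) (fun j => SemidirectProduct.inl (f j))
  refine ⟨c, (Subgroup.eq_top_iff' _).2 fun x => ?_⟩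
  have hl : (⊤ : Subgroup K) ≤
      (Subgroup.closure (Set.range c)).comap SemidirectProduct.inl := by
    rw [← hf, Subgroup.closure_le]
    rintro _ ⟨j, rfl⟩
    exact Subgroup.subset_closure ⟨j.succ, rfl⟩
  have hr : SemidirectProduct.inr x.right ∈ Subgroup.closure (Set.range c) := by
    have h1 : SemidirectProduct.inr (ofAdd 1) ∈ Subgroup.closure (Set.range c) :=
      Subgroup.subset_closure ⟨0, rfl⟩
    have h2 : x.right = ofAdd (1 : ℤ) ^ toAdd x.right := by
      rw [← ofAdd_zsmul]; simp
    rw [h2, map_zpow]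
    exact Subgroup.zpow_mem _ h1 _
  rw [← SemidirectProduct.inl_left_mul_inr_right x]
  exact mul_mem (hl (Subgroup.mem_top x.left)) hr

/-- If `α : K →* Q` and `β : G →* Q` are compatible with the action `φ` of `G` on `K` for an
element `t` generating `G`, then they are compatible for every element of `G`. -/
theorem comp_eq_conj_comp_of_generator {K G Q : Type*} [Group K] [Group G] [Group Q]
    {φ : G →* MulAut K} {α : K →* Q} {β : G →* Q} {t : G}
    (ht : Subgroup.zpowers t = ⊤) (h : ∀ k, α (φ t k) = β t * α k * (β t)⁻¹) (n : G) :
    α.comp (φ n).toMonoidHom = (MulAut.conj (β n)).toMonoidHom.comp α := by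
  let S : Subgroup G :=
    { carrier := {n | ∀ k, α (φ n k) = β n * α k * (β n)⁻¹}
      one_mem' := fun k => by simp
      mul_mem' := fun {a b} ha hb k => by
        simp only [Set.mem_ofPred_eq] at ha hb
        simp [ha, hb, mul_assoc]
      inv_mem' := fun {a} ha k => by
        have := ha (φ a⁻¹ k)
        rw [← MulAut.mul_apply, ← map_mul, mul_inv_cancel, map_one, MulAut.one_apply] at this
        simp [this, mul_assoc] }
  have hS : n ∈ S := by
    have : Subgroup.zpowers t ≤ S := (Subgroup.zpowers_le).2 h
    exact this (ht ▸ Subgroup.mem_top n)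
  exact MonoidHom.ext hS

open Multiplicative in
/-- A presentation of `K` with `g` generators and `r` relators and a generating family of `K` of
size `s` yield a presentation of `K ⋊[φ] ℤ` with one more generator and `s` more relators. -/
theorem HasPresentation.semidirectProduct_int {K : Type*} [Group K]
    (φ : Multiplicative ℤ →* MulAut K) {s g r : ℕ} (hgen : GeneratedByN K s)
    (hpres : HasPresentation K g r) :
    HasPresentation (K ⋊[φ] Multiplicative ℤ) (g + 1) (r + s) := by
  obtain ⟨f, hf⟩ := hgen
  obtain ⟨rels, ⟨e⟩⟩ := hpres
  let t : Multiplicative ℤ := ofAdd 1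
  let p : FreeGroup (Fin g) →* K := e.symm.toMonoidHom.comp (QuotientGroup.mk' _)
  have hp : Function.Surjective p := e.symm.surjective.comp (QuotientGroup.mk'_surjective _)
  have hep (x) : e (p x) = QuotientGroup.mk' _ x := e.apply_symm_apply _
  have hprels (i) : p (rels i) = 1 := by
    apply e.injective
    rw [hep, map_one]
    exact (QuotientGroup.eq_one_iff _).2 (Subgroup.subset_normalClosure ⟨i, rfl⟩)
  choose w hw using fun j => hp (f j)
  choose v hv using fun j => hp (φ t (f j))
  let ι : FreeGroup (Fin g) →* FreeGroup (Fin (g + 1)) := FreeGroup.map Fin.succ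
  let R : Fin (r + s) → FreeGroup (Fin (g + 1)) := Fin.append (fun i => ι (rels i))
    (fun j => FreeGroup.of 0 * ι (w j) * (FreeGroup.of 0)⁻¹ * (ι (v j))⁻¹)
  let π : FreeGroup (Fin (g + 1)) →*
      FreeGroup (Fin (g + 1)) ⧸ Subgroup.normalClosure (Set.range R) :=
    QuotientGroup.mk' _
  have hπ (i) : π (R i) = 1 :=
    (QuotientGroup.eq_one_iff _).2 (Subgroup.subset_normalClosure ⟨i, rfl⟩)
  let q : FreeGroup (Fin (g + 1)) →* K ⋊[φ] Multiplicative ℤ :=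
    FreeGroup.lift (Fin.cons (SemidirectProduct.inr t)
      (fun i => SemidirectProduct.inl (p (FreeGroup.of i))))
  have hqι : q.comp ι = SemidirectProduct.inl.comp p := by
    ext i : 1
    simp [q, ι]
  have hqι' (x) : q (ι x) = SemidirectProduct.inl (p x) := DFunLike.congr_fun hqι x
  have hq0 : q (FreeGroup.of 0) = SemidirectProduct.inr t := by simp [q]
  have hqR : Subgroup.normalClosure (Set.range R) ≤ q.ker := by
    refine Subgroup.normalClosure_le_normal ?_
    rintro _ ⟨i, rfl⟩
    refine MonoidHom.mem_ker.2 ?_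
    induction i using Fin.addCases with
    | left i => simp [R, hqι', hprels]
    | right j =>
      simp only [R, Fin.append_right, map_mul, map_inv, hqι', hq0, hw, hv,
        SemidirectProduct.inl_aut]
      simp
  let fwd := QuotientGroup.lift _ q hqR
  have hαker : Subgroup.normalClosure (Set.range rels) ≤ (π.comp ι).ker := by
    refine Subgroup.normalClosure_le_normal ?_
    rintro _ ⟨i, rfl⟩
    have := hπ (Fin.castAdd s i)
    simpa [R, MonoidHom.mem_ker] using this
  let α : K →* FreeGroup (Fin (g + 1)) ⧸ Subgroup.normalClosure (Set.range R) :=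
    (QuotientGroup.lift _ (π.comp ι) hαker).comp e.toMonoidHom
  have hα (x) : α (p x) = π (ι x) := by
    change QuotientGroup.lift _ (π.comp ι) hαker (e (p x)) = _
    rw [hep]
    rfl
  let β := zpowersHom _ (π (FreeGroup.of 0))
  have hβ : β t = π (FreeGroup.of 0) := by simp [β, t]
  have hαβ : α.comp (φ t).toMonoidHom = (MulAut.conj (β t)).toMonoidHom.comp α := by
    refine MonoidHom.eq_of_eqOn_dense hf ?_
    rintro _ ⟨j, rfl⟩
    have := hπ (Fin.natAdd r j)
    simp only [R, Fin.append_right, map_mul, map_inv, mul_inv_eq_one] at this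
    change α (φ t (f j)) = β t * α (f j) * (β t)⁻¹
    rw [← hv, hα, hβ, ← this, ← hw, hα]
  have ht : Subgroup.zpowers t = ⊤ := by
    refine (Subgroup.eq_top_iff' _).2 fun n => ⟨toAdd n, ?_⟩
    simp only [t]
    rw [← ofAdd_zsmul]; simp
  let bwd := SemidirectProduct.lift α β
    (comp_eq_conj_comp_of_generator ht fun k => DFunLike.congr_fun hαβ k)
  refine ⟨R, ⟨MonoidHom.toMulEquiv bwd fwd ?_ ?_⟩⟩
  · refine SemidirectProduct.hom_ext ?_ ?_
    · ext k : 1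
      obtain ⟨x, rfl⟩ := hp k
      change fwd (bwd (SemidirectProduct.inl (p x))) = _
      rw [SemidirectProduct.lift_inl, hα]
      exact hqι' x
    · refine MonoidHom.ext_mint ?_
      change fwd (bwd (SemidirectProduct.inr t)) = _
      rw [SemidirectProduct.lift_inr, hβ]
      exact hq0
  · refine QuotientGroup.monoidHom_ext _ (FreeGroup.ext_hom _ _ fun i => ?_)
    change bwd (q (FreeGroup.of i)) = π (FreeGroup.of i)
    refine Fin.cases ?_ (fun i => ?_) i
    · rw [hq0, SemidirectProduct.lift_inr, hβ]
    · have := hqι' (FreeGroup.of i)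
      simp only [ι, FreeGroup.map.of] at this
      rw [this, SemidirectProduct.lift_inl, hα]
      simp [ι]

/-- If `π = K ⋊_φ ℤ` with `K` finitely presentable and generated by `s` elements,
then `π` can be generated by `s + 1` elements and `def π ≥ 1 + def K − s`: from a
presentation of `K` with `g` generators and `r` relations one obtains a presentation
of `π` with `g' - r' ≥ 1 + (g - r) - s`. -/
theorem semidirect_product_with_Z_generators_and_deficiency (K : Type*) [Group K]
    (φ : Multiplicative ℤ →* MulAut K) (s : ℕ) (hgen : GeneratedByN K s)
    (g r : ℕ) (hpres : HasPresentation K g r) :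
    GeneratedByN (K ⋊[φ] Multiplicative ℤ) (s + 1) ∧
    ∃ g' r' : ℕ, HasPresentation (K ⋊[φ] Multiplicative ℤ) g' r' ∧
      1 + ((g : ℤ) - (r : ℤ)) - (s : ℤ) ≤ (g' : ℤ) - (r' : ℤ) := by
  refine ⟨hgen.semidirectProduct_int φ, g + 1, r + s, hpres.semidirectProduct_int φ hgen, ?_⟩
  push_cast
  linarith
end

section
/- For every n ≥ 1, the free abelian group ℤⁿ has deficiency def(ℤⁿ) = n − n(n−1)/2; that is, ℤⁿ has a finite presentation with n generators and n(n−1)/2 relations, and every finite presentation of ℤⁿ with g generators and r relations satisfies g − r ≤ n − n(n−1)/2. -/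
/-- The central extension of `V` by `A` whose cocycle is the biadditive map `B`. -/
@[ext]
structure CentralExt {V A : Type*} [AddCommGroup V] [AddCommGroup A] (B : V →+ V →+ A) where
  /-- The component in the quotient. -/
  fst : V
  /-- The component in the kernel. -/
  snd : A

namespace CentralExt

variable {V A : Type*} [AddCommGroup V] [AddCommGroup A] {B : V →+ V →+ A}

instance : Mul (CentralExt B) := ⟨fun x y => ⟨x.fst + y.fst, x.snd + y.snd + B x.fst y.fst⟩⟩

instance : One (CentralExt B) := ⟨⟨0, 0⟩⟩

instance : Inv (CentralExt B) := ⟨fun x => ⟨-x.fst, -x.snd + B x.fst x.fst⟩⟩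

@[simp] lemma mul_fst (x y : CentralExt B) : (x * y).fst = x.fst + y.fst := rfl

@[simp] lemma mul_snd (x y : CentralExt B) :
    (x * y).snd = x.snd + y.snd + B x.fst y.fst := rfl

@[simp] lemma one_fst : (1 : CentralExt B).fst = 0 := rfl

@[simp] lemma one_snd : (1 : CentralExt B).snd = 0 := rfl

@[simp] lemma inv_fst (x : CentralExt B) : x⁻¹.fst = -x.fst := rfl

@[simp] lemma inv_snd (x : CentralExt B) : x⁻¹.snd = -x.snd + B x.fst x.fst := rfl

instance : Group (CentralExt B) :=
  Group.ofLeftAxioms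
    (fun x y z => by
      ext
      · simp [add_assoc]
      · simp only [mul_snd, mul_fst, map_add, AddMonoidHom.add_apply]; abel)
    (fun x => by ext <;> simp)
    (fun x => by ext <;> simp)

/-- The projection of a central extension onto its quotient. -/
def fstHom (B : V →+ V →+ A) : CentralExt B →* Multiplicative V where
  toFun x := Multiplicative.ofAdd x.fst
  map_one' := rfl
  map_mul' _ _ := rfl

@[simp] lemma fstHom_apply (x : CentralExt B) :
    fstHom B x = Multiplicative.ofAdd x.fst := rfl

open scoped commutatorElement in
lemma commutator_snd (x y : CentralExt B) :
    ⁅x, y⁆.snd = B x.fst y.fst - B y.fst x.fst := by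
  simp only [commutatorElement_def, mul_snd, mul_fst, inv_fst, inv_snd, map_add, map_neg,
    AddMonoidHom.add_apply, AddMonoidHom.neg_apply]
  abel

/-- The central subgroup of a central extension given by a subgroup of its kernel. -/
def central (B : V →+ V →+ A) (S : AddSubgroup A) : Subgroup (CentralExt B) where
  carrier := {x | x.fst = 0 ∧ x.snd ∈ S}
  one_mem' := ⟨rfl, S.zero_mem⟩
  mul_mem' := by
    rintro x y ⟨hx, hx'⟩ ⟨hy, hy'⟩
    exact ⟨by simp [hx, hy], by simpa [hx] using S.add_mem hx' hy'⟩
  inv_mem' := by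
    rintro x ⟨hx, hx'⟩
    exact ⟨by simp [hx], by simpa [hx] using hx'⟩

lemma mem_central {S : AddSubgroup A} {x : CentralExt B} :
    x ∈ central B S ↔ x.fst = 0 ∧ x.snd ∈ S := Iff.rfl

instance (S : AddSubgroup A) : (central B S).Normal where
  conj_mem := by
    rintro x ⟨hx, hx'⟩ y
    refine ⟨by simp [hx], ?_⟩
    convert hx' using 1
    simp only [mul_snd, mul_fst, inv_fst, inv_snd, hx, map_zero, map_neg, add_zero]
    abel

end CentralExt

/-- The pairs `i < j` of indices below `n`. -/
abbrev LTPair (n : ℕ) : Type := {p : Fin n × Fin n // p.1 < p.2}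

lemma card_ltPair (n : ℕ) : Fintype.card (LTPair n) = n * (n - 1) / 2 := by
  have e : LTPair n ≃ Σ j : Fin n, Fin j :=
    { toFun p := ⟨p.1.2, ⟨p.1.1, p.2⟩⟩
      invFun s := ⟨(⟨s.2, s.2.2.trans s.1.2⟩, s.1), s.2.2⟩
      left_inv _ := rfl
      right_inv _ := rfl }
  rw [Fintype.card_congr e, Fintype.card_sigma]
  simp only [Fintype.card_fin]
  rw [Fin.sum_univ_eq_sum_range (fun i => i), Finset.sum_range_id]

open scoped commutatorElement in
lemma FreeGroup.commutator_eq_normalClosure (n : ℕ) :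
    commutator (FreeGroup (Fin n)) = Subgroup.normalClosure
      (Set.range fun p : LTPair n => ⁅FreeGroup.of p.1.1, FreeGroup.of p.1.2⁆) := by
  set N := Subgroup.normalClosure
      (Set.range fun p : LTPair n => ⁅FreeGroup.of p.1.1, FreeGroup.of p.1.2⁆)
  have lt_comm (i j : Fin n) (hij : i < j) :
      Commute (QuotientGroup.mk' N (.of i)) (QuotientGroup.mk' N (.of j)) := by
    rw [← commutatorElement_eq_one_iff_commute, ← map_commutatorElement,
      QuotientGroup.mk'_apply, QuotientGroup.eq_one_iff]
    exact Subgroup.subset_normalClosure ⟨⟨(i, j), hij⟩, rfl⟩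
  have gen_comm (i j : Fin n) :
      Commute (QuotientGroup.mk' N (.of i)) (QuotientGroup.mk' N (.of j)) := by
    rcases lt_trichotomy i j with h | rfl | h
    · exact lt_comm i j h
    · exact Commute.refl _
    · exact (lt_comm j i h).symm
  have comm_of_gen (x : FreeGroup (Fin n) ⧸ N)
      (hx : ∀ i, Commute x (QuotientGroup.mk' N (.of i))) (f : FreeGroup (Fin n)) :
      Commute x (QuotientGroup.mk' N f) := by
    induction f using FreeGroup.induction_on with
    | C1 => simp
    | of i => exact hx i
    | inv_of i h => rw [_root_.map_inv]; exact h.inv_right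
    | mul a b ha hb => rw [_root_.map_mul]; exact ha.mul_right hb
  have comm (a b : FreeGroup (Fin n)) :
      Commute (QuotientGroup.mk' N a) (QuotientGroup.mk' N b) :=
    comm_of_gen _ (fun i => (comm_of_gen _ (gen_comm i) a).symm) b
  refine le_antisymm ?_ (Subgroup.normalClosure_le_normal ?_)
  · rw [commutator_def, Subgroup.commutator_le]
    intro a _ b _
    rw [← QuotientGroup.eq_one_iff, ← QuotientGroup.mk'_apply, map_commutatorElement]
    exact commutatorElement_eq_one_iff_commute.mpr (comm a b)
  · rintro _ ⟨p, rfl⟩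
    exact Subgroup.commutator_mem_commutator (Subgroup.mem_top _) (Subgroup.mem_top _)

open scoped commutatorElement in
lemma hasPresentation_free_abelian (n : ℕ) :
    HasPresentation (Multiplicative (Fin n → ℤ)) n (n * (n - 1) / 2) := by
  have e : Fin (n * (n - 1) / 2) ≃ LTPair n := (Fintype.equivFinOfCardEq (card_ltPair n)).symm
  have e₁ : FreeAbelianGroup (Fin n) ≃+ (Fin n → ℤ) :=
    (FreeAbelianGroup.equivFinsupp (Fin n)).trans
      (Finsupp.linearEquivFunOnFinite ℤ ℤ (Fin n)).toAddEquiv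
  have e₂ : Abelianization (FreeGroup (Fin n)) ≃* Multiplicative (Fin n → ℤ) :=
    AddEquiv.toMultiplicativeRight e₁
  refine ⟨(fun p : LTPair n => ⁅FreeGroup.of p.1.1, FreeGroup.of p.1.2⁆) ∘ e,
    ⟨e₂.symm.trans (QuotientGroup.quotientMulEquivOfEq ?_)⟩⟩
  rw [e.surjective.range_comp]
  exact FreeGroup.commutator_eq_normalClosure n

/-- The biadditive map whose commutator form is the universal alternating form on `ℤⁿ`,
viewed in `E × ℚ^(n choose 2)`. -/
def alternatingCocycle (n : ℕ) (E : Type*) [AddCommGroup E] :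
    (Fin n → ℤ) →+ (Fin n → ℤ) →+ E × (LTPair n → ℚ) :=
  AddMonoidHom.mk' (fun v => AddMonoidHom.mk' (fun w => (0, fun p => v p.1.1 * w p.1.2))
      fun w w' => by ext <;> simp [mul_add])
    fun v v' => by ext <;> simp [add_mul]

lemma alternatingCocycle_apply (n : ℕ) (E : Type*) [AddCommGroup E] (v w : Fin n → ℤ) :
    alternatingCocycle n E v w = (0, fun p => (v p.1.1 * w p.1.2 : ℚ)) := rfl

lemma alternatingCocycle_single_sub (n : ℕ) (E : Type*) [AddCommGroup E] (p : LTPair n) :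
    alternatingCocycle n E (Pi.single p.1.1 1) (Pi.single p.1.2 1) -
      alternatingCocycle n E (Pi.single p.1.2 1) (Pi.single p.1.1 1) = (0, Pi.single p 1) := by
  obtain ⟨⟨i, j⟩, hij⟩ := p
  simp only [alternatingCocycle_apply, Prod.mk_sub_mk, sub_zero, Prod.mk.injEq, true_and]
  ext ⟨⟨k, l⟩, hkl⟩
  simp only [Pi.sub_apply, Pi.single_apply, Subtype.mk.injEq, Prod.mk.injEq]
  simp only at hij hkl
  have : ¬ (k = j ∧ l = i) := by rintro ⟨rfl, rfl⟩; exact lt_asymm hij hkl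
  split_ifs <;> simp_all

open scoped commutatorElement in
lemma HasPresentation.add_choose_le {n g r : ℕ}
    (h : HasPresentation (Multiplicative (Fin n → ℤ)) g r) :
    g + n * (n - 1) / 2 ≤ r + n := by
  obtain ⟨rels, ⟨e⟩⟩ := h
  set N := Subgroup.normalClosure (Set.range rels)
  let φ : FreeGroup (Fin g) →* Multiplicative (Fin n → ℤ) :=
    e.symm.toMonoidHom.comp (QuotientGroup.mk' N)
  have φ_surj : Function.Surjective φ :=
    e.symm.surjective.comp (QuotientGroup.mk'_surjective N)
  have φ_ker (x : FreeGroup (Fin g)) : φ x = 1 ↔ x ∈ N := by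
    simp [φ]
  let B := alternatingCocycle n (Fin g → ℚ)
  let Ψ : FreeGroup (Fin g) →* CentralExt B :=
    FreeGroup.lift fun k => ⟨(φ (.of k)).toAdd, (Pi.single k 1, 0)⟩
  have Ψ_fst (x : FreeGroup (Fin g)) : (Ψ x).fst = (φ x).toAdd := by
    have : (CentralExt.fstHom B).comp Ψ = φ := FreeGroup.ext_hom _ _ fun k => by simp [Ψ]
    rw [← this]; rfl
  let ab : FreeGroup (Fin g) →* Multiplicative (Fin g → ℚ) :=
    MonoidHom.mk' (fun x => Multiplicative.ofAdd (Ψ x).snd.1) fun x y => by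
      rw [map_mul, CentralExt.mul_snd, ← ofAdd_add]
      simp [B, alternatingCocycle_apply]
  have ab_apply (x : FreeGroup (Fin g)) : (ab x).toAdd = (Ψ x).snd.1 := rfl
  let S : Submodule ℚ ((Fin g → ℚ) × (LTPair n → ℚ)) :=
    Submodule.span ℚ (Set.range fun k => (Ψ (rels k)).snd)
  have mem_S (x : FreeGroup (Fin g)) (hx : φ x = 1) : (Ψ x).snd ∈ S := by
    have : N ≤ (CentralExt.central B S.toAddSubgroup).comap Ψ := by
      refine Subgroup.normalClosure_le_normal ?_
      rintro _ ⟨k, rfl⟩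
      refine ⟨?_, Submodule.subset_span ⟨k, rfl⟩⟩
      rw [Ψ_fst, (φ_ker _).mpr (Subgroup.subset_normalClosure ⟨k, rfl⟩)]
      rfl
    exact (this ((φ_ker x).mp hx)).2
  choose f hf using fun i : Fin n => φ_surj (Multiplicative.ofAdd (Pi.single i 1))
  have single_mem (p : LTPair n) : ((0, Pi.single p 1) : (Fin g → ℚ) × (LTPair n → ℚ)) ∈ S := by
    have := mem_S ⁅f p.1.1, f p.1.2⁆ (by
      rw [map_commutatorElement, commutatorElement_eq_one_iff_commute]; exact Commute.all _ _)
    rw [map_commutatorElement, CentralExt.commutator_snd, Ψ_fst, Ψ_fst, hf, hf] at this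
    rwa [← alternatingCocycle_single_sub]
  have right_mem (c : LTPair n → ℚ) : ((0, c) : (Fin g → ℚ) × (LTPair n → ℚ)) ∈ S := by
    have : LinearMap.range (LinearMap.inr ℚ (Fin g → ℚ) (LTPair n → ℚ)) ≤ S := by
      rw [LinearMap.range_eq_map, ← (Pi.basisFun ℚ (LTPair n)).span_eq, Submodule.map_span,
        Submodule.span_le]
      rintro _ ⟨_, ⟨p, rfl⟩, rfl⟩
      simpa using single_mem p
    exact this ⟨c, rfl⟩
  let T : Submodule ℚ ((Fin g → ℚ) × (LTPair n → ℚ)) :=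
    Submodule.span ℚ (Set.range fun i => ((ab (f i)).toAdd, 0))
  have lift_mem (m : Multiplicative (Fin n → ℤ)) :
      ∃ w, φ w = m ∧ (((ab w).toAdd, 0) : (Fin g → ℚ) × (LTPair n → ℚ)) ∈ T := by
    let K : Subgroup (FreeGroup (Fin g)) := Subgroup.comap ab
      (AddSubgroup.toSubgroup (T.comap (LinearMap.inl ℚ _ _)).toAddSubgroup)
    suffices m ∈ K.map φ by
      obtain ⟨w, hw, hwm⟩ := this
      exact ⟨w, hwm, hw⟩
    have hm : m = ∏ i, Multiplicative.ofAdd (Pi.single i 1 : Fin n → ℤ) ^ (m.toAdd i) := by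
      apply Multiplicative.toAdd.injective
      rw [toAdd_prod]
      ext j
      simp [Finset.sum_apply, Pi.single_apply]
    rw [hm]
    refine Subgroup.prod_mem _ fun i _ => Subgroup.zpow_mem _ ?_ _
    exact ⟨f i, Submodule.subset_span ⟨i, rfl⟩, hf i⟩
  have left_mem (k : Fin g) :
      ((Pi.single k 1, 0) : (Fin g → ℚ) × (LTPair n → ℚ)) ∈ S ⊔ T := by
    obtain ⟨w, hw, hwT⟩ := lift_mem (φ (.of k))
    have hS := mem_S (.of k * w⁻¹) (by simp [hw])
    have hS' := S.sub_mem hS (right_mem (Ψ (.of k * w⁻¹)).snd.2)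
    convert (S ⊔ T).add_mem (Submodule.mem_sup_left hS') (Submodule.mem_sup_right hwT) using 1
    ext1
    · rw [Prod.fst_add, Prod.fst_sub, ← ab_apply, map_mul, map_inv]
      have : (ab (.of k)).toAdd = Pi.single k 1 := by simp [ab_apply, Ψ]
      simp [this]
    · simp
  have top : S ⊔ T = ⊤ := by
    rw [eq_top_iff, ← ((Pi.basisFun ℚ (Fin g)).prod (Pi.basisFun ℚ (LTPair n))).span_eq,
      Submodule.span_le]
    rintro _ ⟨k | p, rfl⟩
    · simpa using left_mem k
    · simpa using Submodule.mem_sup_left (single_mem p)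
  have hdim : Module.finrank ℚ ((Fin g → ℚ) × (LTPair n → ℚ)) = g + n * (n - 1) / 2 := by
    rw [Module.finrank_prod, Module.finrank_fintype_fun_eq_card,
      Module.finrank_fintype_fun_eq_card, card_ltPair, Fintype.card_fin]
  have hS : Module.finrank ℚ S ≤ r := by
    simpa [Set.finrank] using finrank_range_le_card (R := ℚ) fun k => (Ψ (rels k)).snd
  have hT : Module.finrank ℚ T ≤ n := by
    simpa [Set.finrank] using finrank_range_le_card (R := ℚ)
      fun i => (((ab (f i)).toAdd, 0) : (Fin g → ℚ) × (LTPair n → ℚ))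
  calc g + n * (n - 1) / 2
      = Module.finrank ℚ ↥(S ⊔ T) := by rw [top, finrank_top, hdim]
    _ ≤ Module.finrank ℚ S + Module.finrank ℚ T := Submodule.finrank_add_le_finrank_add_finrank S T
    _ ≤ r + n := add_le_add hS hT

/-- For `n ≥ 1`, the free abelian group `ℤⁿ` has deficiency `n − n(n−1)/2`: it has a
finite presentation with `n` generators and `n(n−1)/2` relations, and every finite
presentation satisfies `g - r ≤ n − n(n−1)/2`. -/
theorem deficiency_free_abelian (n : ℕ) (hn : 1 ≤ n) :
    HasPresentation (Multiplicative (Fin n → ℤ)) n (n * (n - 1) / 2) ∧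
    ∀ g r : ℕ, HasPresentation (Multiplicative (Fin n → ℤ)) g r →
      (g : ℤ) - (r : ℤ) ≤ (n : ℤ) - ((n * (n - 1) / 2 : ℕ) : ℤ) := by
  refine ⟨hasPresentation_free_abelian n, fun g r h => ?_⟩
  have := h.add_choose_le
  omega
end

section
/- Let Kb denote the Klein bottle group ⟨a, b | bab⁻¹ = a⁻¹⟩. Then def(ℤ² × Kb) = −2; that is, ℤ² × Kb has a finite presentation with g generators and r relations with g − r = −2, and every finite presentation of ℤ² × Kb with g generators and r relations satisfies g − r ≤ −2. -/
/-- Relator of the Klein bottle group `⟨a, b ∣ bab⁻¹ = a⁻¹⟩`,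
with `a, b` the generators `0, 1`. -/
def kbRels : Set (FreeGroup (Fin 2)) :=
  {FreeGroup.of (1 : Fin 2) * FreeGroup.of (0 : Fin 2) * (FreeGroup.of (1 : Fin 2))⁻¹ *
    FreeGroup.of (0 : Fin 2)}

/-- The Klein bottle group `⟨a, b ∣ bab⁻¹ = a⁻¹⟩`. -/
abbrev KleinBottleGroup : Type := PresentedGroup kbRels

/-- The Heisenberg group over a ring `K`: triples `(a, b, c)` multiplied as the upper unitriangular
`3 × 3` matrices with `a`, `b` above the diagonal and `c` in the corner. -/
@[ext]
structure Heisenberg (K : Type*) where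
  a : K
  b : K
  c : K

namespace Heisenberg

variable {K : Type*} [CommRing K]

instance : Mul (Heisenberg K) := ⟨fun x y => ⟨x.a + y.a, x.b + y.b, x.c + y.c + x.a * y.b⟩⟩

instance : One (Heisenberg K) := ⟨⟨0, 0, 0⟩⟩

instance : Inv (Heisenberg K) := ⟨fun x => ⟨-x.a, -x.b, -x.c + x.a * x.b⟩⟩

theorem mul_def (x y : Heisenberg K) :
    x * y = ⟨x.a + y.a, x.b + y.b, x.c + y.c + x.a * y.b⟩ := rfl

theorem one_def : (1 : Heisenberg K) = ⟨0, 0, 0⟩ := rfl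

theorem inv_def (x : Heisenberg K) : x⁻¹ = ⟨-x.a, -x.b, -x.c + x.a * x.b⟩ := rfl

instance : Group (Heisenberg K) :=
  Group.ofLeftAxioms
    (fun x y z => by ext <;> simp only [mul_def] <;> ring)
    (fun x => by ext <;> simp [mul_def, one_def])
    (fun x => by ext <;> simp [mul_def, one_def, inv_def])

/-- The first superdiagonal entry, as a homomorphism. -/
def aHom : Heisenberg K →* Multiplicative K where
  toFun x := .ofAdd x.a
  map_one' := rfl
  map_mul' _ _ := rfl

/-- The second superdiagonal entry, as a homomorphism. -/
def bHom : Heisenberg K →* Multiplicative K where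
  toFun x := .ofAdd x.b
  map_one' := rfl
  map_mul' _ _ := rfl

end Heisenberg

/-- On a free group, the cup product of two homomorphisms to `K` is a coboundary. -/
theorem exists_primitive_cup_freeGroup {X K : Type*} [CommRing K]
    (p q : FreeGroup X →* Multiplicative K) :
    ∃ u : FreeGroup X → K, ∀ x y, u (x * y) = u x + u y + (p x).toAdd * (q y).toAdd := by
  let φ : FreeGroup X →* Heisenberg K :=
    FreeGroup.lift fun i => ⟨(p (.of i)).toAdd, (q (.of i)).toAdd, 0⟩
  have hp : Heisenberg.aHom.comp φ = p := by
    ext i; simp [φ, Heisenberg.aHom]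
  have hq : Heisenberg.bHom.comp φ = q := by
    ext i; simp [φ, Heisenberg.bHom]
  refine ⟨fun x => (φ x).c, fun x y => ?_⟩
  simp only [← hp, ← hq, map_mul]
  rfl

/-- If `G` has a presentation with `g` generators and `r` relators, is generated by the family `s`,
and carries a family of linearly independent cup products of degree-one classes over `K`, then
the number of cup products plus `g` is at most `r` plus the number of elements of `s`. -/
theorem card_add_le_of_independent_cup {G K κ σ : Type*} [Group G] [Field K] [Fintype κ]
    [Fintype σ] {g r : ℕ} (hG : HasPresentation G g r) (s : σ → G)
    (hs : Subgroup.closure (Set.range s) = ⊤) (p q : κ → G →* Multiplicative K)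
    (hpq : ∀ (α : κ → K) (u : G → K),
      (∀ x y, u (x * y) = u x + u y + ∑ k, α k * ((p k x).toAdd * (q k y).toAdd)) → α = 0) :
    Fintype.card κ + g ≤ r + Fintype.card σ := by
  classical
  obtain ⟨rels, ⟨e⟩⟩ := hG
  let π : FreeGroup (Fin g) →* G := e.symm.toMonoidHom.comp (QuotientGroup.mk' _)
  have hπ : Function.Surjective π := e.symm.surjective.comp (QuotientGroup.mk'_surjective _)
  have hker : ∀ x, π x = 1 ↔ x ∈ Subgroup.normalClosure (Set.range rels) := fun x => by
    simp [π]
  choose u hu using fun k => exists_primitive_cup_freeGroup ((p k).comp π) ((q k).comp π)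
  let v : Fin g → FreeGroup (Fin g) →* Multiplicative K := fun j =>
    FreeGroup.lift fun i => .ofAdd (if i = j then 1 else 0)
  let w : κ ⊕ Fin g → FreeGroup (Fin g) → K := Sum.elim u fun j x => (v j x).toAdd
  let t : G → FreeGroup (Fin g) := Function.surjInv hπ
  have ht : ∀ x, π (t x) = x := Function.surjInv_eq hπ
  let M : Matrix (Fin r ⊕ σ) (κ ⊕ Fin g) K := fun i l => w l (Sum.elim rels (t ∘ s) i)
  suffices hM : Function.Injective M.mulVecLin by
    simpa using LinearMap.finrank_le_finrank_of_injective hM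
  rw [injective_iff_map_eq_zero]
  intro c hc
  let Q : FreeGroup (Fin g) → K := fun x => ∑ l, w l x * c l
  have hQM : ∀ i, Q (Sum.elim rels (t ∘ s) i) = 0 := fun i => congrFun hc i
  have hQ : ∀ x y, Q (x * y) = Q x + Q y +
      ∑ k, c (.inl k) * ((p k (π x)).toAdd * (q k (π y)).toAdd) := fun x y => by
    simp only [Q, w, Fintype.sum_sum_type, Sum.elim_inl, Sum.elim_inr, hu, map_mul, toAdd_mul,
      add_mul, Finset.sum_add_distrib, MonoidHom.comp_apply]
    simp only [mul_comm (c _)]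
    ring
  have hQl : ∀ x y, π x = 1 → Q (x * y) = Q x + Q y := fun x y hx => by simp [hQ, hx]
  have hQr : ∀ x y, π y = 1 → Q (x * y) = Q x + Q y := fun x y hy => by simp [hQ, hy]
  have hQ1 : Q 1 = 0 := by simpa using hQl 1 1 (map_one π)
  let S : Subgroup (FreeGroup (Fin g)) :=
    { carrier := {x | π x = 1 ∧ Q x = 0}
      one_mem' := ⟨map_one π, hQ1⟩
      mul_mem' := fun {x y} hx hy =>
        ⟨by rw [map_mul, hx.1, hy.1, one_mul], by rw [hQl x y hx.1, hx.2, hy.2, add_zero]⟩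
      inv_mem' := fun {x} hx =>
        ⟨by rw [map_inv, hx.1, inv_one], by simpa [hQ1, hx.2] using (hQl x x⁻¹ hx.1).symm⟩ }
  have hS : S.Normal := ⟨fun x hx y => by
    have h1 : π (y * x * y⁻¹) = 1 := by simp [hx.1]
    refine ⟨h1, ?_⟩
    have h2 := hQl (y * x * y⁻¹) y h1
    rw [inv_mul_cancel_right, hQr y x hx.1, hx.2, add_zero] at h2
    exact left_eq_add.mp (h2.trans (add_comm _ _))⟩
  have hQker : ∀ x, π x = 1 → Q x = 0 := fun x hx => by
    have hle : Subgroup.normalClosure (Set.range rels) ≤ S := by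
      refine Subgroup.normalClosure_le_normal ?_
      rintro _ ⟨i, rfl⟩
      exact ⟨(hker _).2 (Subgroup.subset_normalClosure ⟨i, rfl⟩), hQM (.inl i)⟩
    exact (hle ((hker x).1 hx)).2
  have hQt : ∀ x, Q (t (π x)) = Q x := fun x => by
    have h1 : π (x * (t (π x))⁻¹) = 1 := by simp [ht]
    have h2 := hQl _ (t (π x)) h1
    rw [inv_mul_cancel_right, hQker _ h1, zero_add] at h2
    exact h2.symm
  have hα : (fun k => c (.inl k)) = 0 := hpq _ (fun x => Q (t x)) fun x y => by
    have h := hQ (t x) (t y)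
    rwa [← hQt, map_mul, ht, ht] at h
  have hα' : ∀ k, c (.inl k) = 0 := fun k => congrFun hα k
  let θ : G →* Multiplicative K := MonoidHom.mk' (fun x => .ofAdd (Q (t x))) fun x y => by
    rw [← ofAdd_add]
    congr 1
    have h := hQ (t x) (t y)
    rw [← hQt, map_mul, ht, ht] at h
    simpa [hα'] using h
  have hθ : θ = 1 := MonoidHom.eq_of_eqOn_dense hs <| by
    rintro _ ⟨i, rfl⟩
    exact congrArg Multiplicative.ofAdd (hQM (.inr i))
  have hQ0 : ∀ x, Q x = 0 := fun x => by
    rw [← hQt]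
    exact congrArg Multiplicative.toAdd (DFunLike.congr_fun hθ (π x))
  ext (k | j)
  · exact hα' k
  · have h := hQ0 (.of j)
    simpa [Q, w, v, hα'] using h

/-- The generators `a`, `b`, `c`, `d` of `ℤ² × Kb`: those of `Kb`, then those of `ℤ²`. -/
def z2KleinGen : Fin 4 → (Multiplicative ℤ × Multiplicative ℤ) × KleinBottleGroup :=
  ![(1, PresentedGroup.of 0), (1, PresentedGroup.of 1), ((.ofAdd 1, 1), 1), ((1, .ofAdd 1), 1)]

theorem KleinBottleGroup.relation :
    (PresentedGroup.of 1 * PresentedGroup.of 0 * (PresentedGroup.of 1)⁻¹ * PresentedGroup.of 0 :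
      KleinBottleGroup) = 1 :=
  PresentedGroup.one_of_mem (rels := kbRels) rfl

theorem closure_range_z2KleinGen : Subgroup.closure (Set.range z2KleinGen) = ⊤ := by
  set H := Subgroup.closure (Set.range z2KleinGen)
  have hmem : ∀ i, z2KleinGen i ∈ H := fun i => Subgroup.subset_closure ⟨i, rfl⟩
  have hK : H.comap (MonoidHom.inr _ _) = ⊤ := by
    rw [eq_top_iff, ← PresentedGroup.closure_range_of, Subgroup.closure_le]
    rintro _ ⟨i, rfl⟩
    fin_cases i
    exacts [hmem 0, hmem 1]
  rw [eq_top_iff]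
  rintro ⟨⟨m, n⟩, k⟩ -
  have hk : ((1, k) : (Multiplicative ℤ × Multiplicative ℤ) × KleinBottleGroup) ∈ H :=
    Subgroup.mem_comap.1 (hK ▸ Subgroup.mem_top k)
  convert H.mul_mem (H.mul_mem (H.zpow_mem (hmem 2) m.toAdd) (H.zpow_mem (hmem 3) n.toAdd)) hk
  all_goals simp [z2KleinGen, ← ofAdd_zsmul]

open scoped commutatorElement

/-- Relators on `a`, `b`, `c`, `d` presenting `ℤ² × Kb`. -/
def z2KleinRels : Fin 6 → FreeGroup (Fin 4) :=
  let x : Fin 4 → FreeGroup (Fin 4) := .of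
  ![x 1 * x 0 * (x 1)⁻¹ * x 0, ⁅x 0, x 2⁆, ⁅x 0, x 3⁆, ⁅x 1, x 2⁆, ⁅x 1, x 3⁆, ⁅x 2, x 3⁆]

theorem hasPresentation_z2Klein :
    HasPresentation ((Multiplicative ℤ × Multiplicative ℤ) × KleinBottleGroup) 4 6 := by
  refine ⟨z2KleinRels, ⟨MulEquiv.symm ?_⟩⟩
  let N := Subgroup.normalClosure (Set.range z2KleinRels)
  let x : Fin 4 → FreeGroup (Fin 4) ⧸ N := fun i => QuotientGroup.mk' N (.of i)
  have hx : Subgroup.closure (Set.range x) = ⊤ := by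
    have : Set.range x = QuotientGroup.mk' N '' Set.range FreeGroup.of := by
      rw [← Set.range_comp]; rfl
    rw [this, ← MonoidHom.map_closure, FreeGroup.closure_range_of, ← MonoidHom.range_eq_map]
    exact MonoidHom.range_eq_top.2 (QuotientGroup.mk'_surjective N)
  have hrel : ∀ i, QuotientGroup.mk' N (z2KleinRels i) = 1 := fun i =>
    (QuotientGroup.eq_one_iff _).2 (Subgroup.subset_normalClosure ⟨i, rfl⟩)
  have h02 : Commute (x 0) (x 2) := commutatorElement_eq_one_iff_commute.1 (hrel 1)
  have h03 : Commute (x 0) (x 3) := commutatorElement_eq_one_iff_commute.1 (hrel 2)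
  have h12 : Commute (x 1) (x 2) := commutatorElement_eq_one_iff_commute.1 (hrel 3)
  have h13 : Commute (x 1) (x 3) := commutatorElement_eq_one_iff_commute.1 (hrel 4)
  have h23 : Commute (x 2) (x 3) := commutatorElement_eq_one_iff_commute.1 (hrel 5)
  have hcen : ∀ i, (∀ j, Commute (x j) (x i)) → ∀ y, Commute (x i) y := fun i hi y => by
    have : Subgroup.closure (Set.range x) ≤ Subgroup.centralizer {x i} := by
      rw [Subgroup.closure_le]
      rintro _ ⟨j, rfl⟩
      exact Subgroup.mem_centralizer_singleton_iff.2 (hi j)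
    exact (Subgroup.mem_centralizer_singleton_iff.1 (this (hx ▸ Subgroup.mem_top y))).symm
  have h2 : ∀ y, Commute (x 2) y := hcen 2 fun j => by
    fin_cases j
    exacts [h02, h12, .refl _, h23.symm]
  have h3 : ∀ y, Commute (x 3) y := hcen 3 fun j => by
    fin_cases j
    exacts [h03, h13, h23, .refl _]
  let fK : KleinBottleGroup →* FreeGroup (Fin 4) ⧸ N :=
    PresentedGroup.toGroup (f := ![x 0, x 1]) <| by
      rintro _ rfl
      simp only [map_mul, map_inv, FreeGroup.lift_apply_of]
      exact hrel 0
  let fZ : Multiplicative ℤ × Multiplicative ℤ →* FreeGroup (Fin 4) ⧸ N :=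
    (zpowersHom _ (x 2)).noncommCoprod (zpowersHom _ (x 3)) fun m n => by
      simpa using (h2 _).zpow_left _
  let f : (Multiplicative ℤ × Multiplicative ℤ) × KleinBottleGroup →* FreeGroup (Fin 4) ⧸ N :=
    fZ.noncommCoprod fK fun m k => by
      simpa [fZ] using ((h2 _).zpow_left _).mul_left ((h3 _).zpow_left _)
  let φ : FreeGroup (Fin 4) →* (Multiplicative ℤ × Multiplicative ℤ) × KleinBottleGroup :=
    FreeGroup.lift z2KleinGen
  have hφ : N ≤ φ.ker := by
    refine Subgroup.normalClosure_le_normal ?_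
    rintro _ ⟨i, rfl⟩
    fin_cases i <;>
      simp [φ, z2KleinRels, z2KleinGen, MonoidHom.mem_ker, commutatorElement_def,
        Prod.ext_iff, KleinBottleGroup.relation]
  let ψ := QuotientGroup.lift N φ hφ
  have hψ : f.comp ψ = MonoidHom.id _ := by
    ext i
    fin_cases i <;> simp [f, ψ, φ, fZ, fK, z2KleinGen, x]
  refine MulEquiv.ofBijective ψ
    ⟨Function.LeftInverse.injective (g := f) (DFunLike.congr_fun hψ), ?_⟩
  refine QuotientGroup.lift_surjective_of_surjective N φ ?_ hφ
  rw [← MonoidHom.range_eq_top, FreeGroup.range_lift_eq_closure, closure_range_z2KleinGen]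

/-- The mod-2 classes on `ℤ² × Kb` dual to the generators `a`, `b`, `c`, `d`. -/
noncomputable def z2KleinClass :
    Fin 4 → (Multiplicative ℤ × Multiplicative ℤ) × KleinBottleGroup →* Multiplicative (ZMod 2) :=
  let kb (f : Fin 2 → Multiplicative (ZMod 2)) (hf : f 0 * f 0 = 1) :
      KleinBottleGroup →* Multiplicative (ZMod 2) :=
    PresentedGroup.toGroup (f := f) <| by
      rintro _ rfl
      simpa [mul_right_comm] using hf
  let z : Multiplicative ℤ →* Multiplicative (ZMod 2) := zpowersHom _ (.ofAdd 1)
  ![(kb ![.ofAdd 1, 1] rfl).comp (MonoidHom.snd _ _),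
    (kb ![1, .ofAdd 1] rfl).comp (MonoidHom.snd _ _),
    z.comp ((MonoidHom.fst _ _).comp (MonoidHom.fst _ _)),
    z.comp ((MonoidHom.snd _ _).comp (MonoidHom.fst _ _))]

theorem z2KleinClass_gen (i j : Fin 4) :
    (z2KleinClass i (z2KleinGen j)).toAdd = if i = j then 1 else 0 := by
  fin_cases i <;> fin_cases j <;> simp [z2KleinClass, z2KleinGen]

/-- The six products of distinct dual classes are linearly independent in `H²(ℤ² × Kb; 𝔽₂)`. -/
theorem z2Klein_cup_independent (α : Fin 6 → ZMod 2)
    (u : (Multiplicative ℤ × Multiplicative ℤ) × KleinBottleGroup → ZMod 2)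
    (hu : ∀ x y, u (x * y) = u x + u y + ∑ k, α k *
      ((z2KleinClass (![0, 0, 0, 1, 1, 2] k) x).toAdd *
        (z2KleinClass (![1, 2, 3, 2, 3, 3] k) y).toAdd)) :
    α = 0 := by
  have key : ∀ i j, z2KleinGen i * z2KleinGen j = z2KleinGen j * z2KleinGen i →
      ∑ k, α k * ((if ![0, 0, 0, 1, 1, 2] k = i then 1 else 0) *
        (if ![1, 2, 3, 2, 3, 3] k = j then 1 else 0)) =
      ∑ k, α k * ((if ![0, 0, 0, 1, 1, 2] k = j then 1 else 0) *
        (if ![1, 2, 3, 2, 3, 3] k = i then 1 else 0)) := fun i j hij => by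
    have h := congrArg u hij
    simp only [hu, z2KleinClass_gen] at h
    rwa [add_comm (u (z2KleinGen j)), add_right_inj] at h
  have h1 := key 0 2 (by simp [z2KleinGen])
  have h2 := key 0 3 (by simp [z2KleinGen])
  have h3 := key 1 2 (by simp [z2KleinGen])
  have h4 := key 1 3 (by simp [z2KleinGen])
  have h5 := key 2 3 (by simp [z2KleinGen])
  have hab : z2KleinGen 1 * z2KleinGen 0 = (z2KleinGen 0)⁻¹ * z2KleinGen 1 := by
    have h := KleinBottleGroup.relation
    rw [mul_eq_one_iff_eq_inv, mul_inv_eq_iff_eq_mul] at h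
    simp [z2KleinGen, h]
  have h0 := congrArg u hab
  have hinv := hu (z2KleinGen 0) (z2KleinGen 0)⁻¹
  have hone : u 1 = 0 := by simpa using hu 1 1
  simp only [hu, map_inv, toAdd_inv, z2KleinClass_gen, mul_inv_cancel] at h0 hinv
  simp [Fin.sum_univ_six] at h0 h1 h2 h3 h4 h5 hinv
  have htwo : (2 : ZMod 2) = 0 := rfl
  have h01 : α 0 = 0 := by
    linear_combination hinv - h0 - hone + u (z2KleinGen 0) * htwo
  ext k
  fin_cases k
  exacts [h01, h1, h2, h3, h4, h5]

/-- `def(ℤ² × Kb) = −2`: `ℤ² × Kb` has a finite presentation with `g − r = −2`, and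
every finite presentation of it satisfies `g − r ≤ −2`. -/
theorem deficiency_Z2_times_Klein_bottle :
    (∃ g r : ℕ,
      HasPresentation ((Multiplicative ℤ × Multiplicative ℤ) × KleinBottleGroup) g r ∧
        (g : ℤ) - (r : ℤ) = -2) ∧
    (∀ g r : ℕ,
      HasPresentation ((Multiplicative ℤ × Multiplicative ℤ) × KleinBottleGroup) g r →
        (g : ℤ) - (r : ℤ) ≤ -2) := by
  refine ⟨⟨4, 6, hasPresentation_z2Klein, by norm_num⟩, fun g r h => ?_⟩
  have := card_add_le_of_independent_cup h z2KleinGen closure_range_z2KleinGen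
    (fun k => z2KleinClass (![0, 0, 0, 1, 1, 2] k)) (fun k => z2KleinClass (![1, 2, 3, 2, 3, 3] k))
    z2Klein_cup_independent
  simp only [Fintype.card_fin] at this
  omega
end

section
/- Let θ = [[1,0,0],[1,5,18],[0,3,11]] ∈ SL(3,ℤ) and let π = ℤ³ ⋊_θ ℤ. Then the abelianization π/π′ is isomorphic to ℤ², yet def(π) = −1: π has a finite presentation of deficiency −1, and every finite presentation of π with g generators and r relations satisfies g − r ≤ −1. -/
/-- The automorphism of `Multiplicative (ℤᵏ)` induced by a matrix `A ∈ GL(k,ℤ)`. -/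
noncomputable def glMulAut {k : ℕ} (A : GL (Fin k) ℤ) :
    MulAut (Multiplicative (Fin k → ℤ)) :=
  AddEquiv.toMultiplicative
    (Matrix.GeneralLinearGroup.toLin A).toLinearEquiv.toAddEquiv

/-- The semidirect product `ℤᵏ ⋊_A ℤ`, in which the generator of `ℤ` acts on `ℤᵏ`
by the automorphism `A ∈ GL(k,ℤ)`. -/
noncomputable abbrev glSemidirect {k : ℕ} (A : GL (Fin k) ℤ) : Type :=
  Multiplicative (Fin k → ℤ)
    ⋊[zpowersHom (MulAut (Multiplicative (Fin k → ℤ))) (glMulAut A)] Multiplicative ℤ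

open SemidirectProduct
open scoped Matrix commutatorElement

section ZPowers

variable {N M : Type*} [Group N] [Group M]

lemma zpowersHom_intertwine (f : N →* M) (α : MulAut N) (β : MulAut M)
    (h : ∀ x, f (α x) = β (f x)) (n : Multiplicative ℤ) (x : N) :
    f (zpowersHom (MulAut N) α n x) = zpowersHom (MulAut M) β n (f x) := by
  simp only [zpowersHom_apply]
  generalize n.toAdd = k
  have h' : ∀ x, f (α⁻¹ x) = β⁻¹ (f x) := fun x => by
    rw [← MulAut.inv_apply_self M β (f (α⁻¹ x)), ← h, MulAut.apply_inv_self]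
  induction k using Int.induction_on generalizing x with
  | zero => simp
  | succ i ih => rw [zpow_add_one, zpow_add_one, MulAut.mul_apply, MulAut.mul_apply, ih, h]
  | pred i ih => rw [zpow_sub_one, zpow_sub_one, MulAut.mul_apply, MulAut.mul_apply, ih, h']

lemma zpowersHom_apply_mem_iff (H : Subgroup N) (α : MulAut N)
    (h : ∀ x, α x ∈ H ↔ x ∈ H) (n : Multiplicative ℤ) (x : N) :
    zpowersHom (MulAut N) α n x ∈ H ↔ x ∈ H := by
  simp only [zpowersHom_apply]
  generalize n.toAdd = k
  induction k using Int.induction_on generalizing x with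
  | zero => simp
  | succ i ih => rw [zpow_add_one, MulAut.mul_apply, ih, h]
  | pred i ih => rw [zpow_sub_one, MulAut.mul_apply, ih, ← h, MulAut.apply_inv_self]

lemma inr_one_mul_inl_mul_inv (α : MulAut N) (x : N) :
    (inr (Multiplicative.ofAdd 1) * inl x * (inr (Multiplicative.ofAdd 1))⁻¹ :
      N ⋊[zpowersHom (MulAut N) α] Multiplicative ℤ) = inl (α x) := by
  rw [← map_inv, ← inl_aut]
  simp

end ZPowers

section Words

variable {P Q : Type*} [Group P] [Group Q]

/-- The element `y` with `t x t⁻¹ = x y`. -/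
def secondGen (x t : P) : P := x⁻¹ * (t * x * t⁻¹)

/-- Four words in three letters `x`, `z`, `t` which are defining relators for `ℤ³ ⋊_θ ℤ`. -/
def relatorWords (x z t : P) : Fin 4 → P :=
  ![⁅x, secondGen x t⁆, ⁅x, z⁆,
    t * secondGen x t * t⁻¹ * (secondGen x t ^ 5 * z ^ 3)⁻¹,
    t * z * t⁻¹ * (secondGen x t ^ 18 * z ^ 11)⁻¹]

lemma map_secondGen (f : P →* Q) (x t : P) :
    f (secondGen x t) = secondGen (f x) (f t) := by
  simp [secondGen]

lemma map_relatorWords (f : P →* Q) (x z t : P) (j : Fin 4) :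
    f (relatorWords x z t j) = relatorWords (f x) (f z) (f t) j := by
  fin_cases j <;> simp [relatorWords, map_secondGen, map_commutatorElement]

/-- The commutator of `y` and `z` is a consequence of the four relators. -/
lemma commute_of_relatorWords {x z t : P} (h : ∀ j, relatorWords x z t j = 1) :
    Commute x (secondGen x t) ∧ Commute x z ∧ Commute (secondGen x t) z ∧
      t * x * t⁻¹ = x * secondGen x t ∧
      t * secondGen x t * t⁻¹ = secondGen x t ^ 5 * z ^ 3 ∧
      t * z * t⁻¹ = secondGen x t ^ 18 * z ^ 11 := by
  have h0 := h 0
  have h1 := h 1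
  have h2 := h 2
  have h3 := h 3
  have hx : t * x * t⁻¹ = x * secondGen x t := by simp [secondGen]
  simp only [relatorWords] at h0 h1 h2 h3
  simp only [Fin.isValue, Matrix.cons_val, commutatorElement_eq_one_iff_commute, mul_inv_eq_one]
    at h0 h1 h2 h3
  set y := secondGen x t
  have conj_commute {a b : P} (hab : Commute a b) : Commute (t * a * t⁻¹) (t * b * t⁻¹) := by
    simpa using hab.map (MulAut.conj t).toMonoidHom
  have c0 := conj_commute h0
  have c1 := conj_commute h1
  rw [hx, h2] at c0
  rw [hx, h3] at c1
  have e3 : Commute y (z ^ 3) := by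
    have : Commute x (y ^ 5 * z ^ 3) := (h0.pow_right 5).mul_right (h1.pow_right 3)
    have c : Commute y (y ^ 5 * z ^ 3) := by
      simpa using this.inv_left.mul_left c0
    simpa using ((Commute.refl y).pow_right 5).inv_right.mul_right c
  have e11 : Commute y (z ^ 11) := by
    have : Commute x (y ^ 18 * z ^ 11) := (h0.pow_right 18).mul_right (h1.pow_right 11)
    have c : Commute y (y ^ 18 * z ^ 11) := by
      simpa using this.inv_left.mul_left c1
    simpa using ((Commute.refl y).pow_right 18).inv_right.mul_right c
  have e : Commute y z := by
    have := (e3.pow_right 4).mul_right e11.inv_right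
    rwa [← pow_mul, show 3 * 4 = 1 + 11 from rfl, pow_add, mul_inv_cancel_right, pow_one] at this
  exact ⟨h0, h1, e, hx, h2, h3⟩

end Words

section Example

variable {θ : GL (Fin 3) ℤ}

lemma toLin_apply_of_eq (hθ : (θ : Matrix (Fin 3) (Fin 3) ℤ) = !![1, 0, 0; 1, 5, 18; 0, 3, 11])
    (u : Fin 3 → ℤ) : (Matrix.GeneralLinearGroup.toLin θ).toLinearEquiv u =
      ![u 0, u 0 + 5 * u 1 + 18 * u 2, 3 * u 1 + 11 * u 2] := by
  have : (Matrix.GeneralLinearGroup.toLin θ).toLinearEquiv u =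
      (θ : Matrix (Fin 3) (Fin 3) ℤ) *ᵥ u := rfl
  rw [this, hθ]
  ext i
  fin_cases i <;> simp [Matrix.mulVec, dotProduct, Fin.sum_univ_three]

lemma glMulAut_apply_of_eq
    (hθ : (θ : Matrix (Fin 3) (Fin 3) ℤ) = !![1, 0, 0; 1, 5, 18; 0, 3, 11])
    (u : Fin 3 → ℤ) : glMulAut θ (Multiplicative.ofAdd u) =
      Multiplicative.ofAdd ![u 0, u 0 + 5 * u 1 + 18 * u 2, 3 * u 1 + 11 * u 2] :=
  congrArg Multiplicative.ofAdd (toLin_apply_of_eq hθ u)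

variable (θ) in
/-- The element of `ℤ³ ⋊_θ ℤ` given by a vector of `ℤ³`. -/
noncomputable def vecElt (u : Fin 3 → ℤ) : glSemidirect θ := inl (Multiplicative.ofAdd u)

variable (θ) in
/-- The stable letter of `ℤ³ ⋊_θ ℤ`. -/
noncomputable def stableLetter : glSemidirect θ := inr (Multiplicative.ofAdd 1)

lemma vecElt_mul (u v : Fin 3 → ℤ) : vecElt θ u * vecElt θ v = vecElt θ (u + v) :=
  (map_mul inl _ _).symm

lemma vecElt_inv (u : Fin 3 → ℤ) : (vecElt θ u)⁻¹ = vecElt θ (-u) :=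
  (map_inv inl _).symm

lemma vecElt_pow (u : Fin 3 → ℤ) (n : ℕ) : vecElt θ u ^ n = vecElt θ (n • u) :=
  (map_pow inl _ _).symm

lemma vecElt_zero : vecElt θ 0 = 1 := map_one inl

lemma stableLetter_conj_vecElt
    (hθ : (θ : Matrix (Fin 3) (Fin 3) ℤ) = !![1, 0, 0; 1, 5, 18; 0, 3, 11]) (u : Fin 3 → ℤ) :
    stableLetter θ * vecElt θ u * (stableLetter θ)⁻¹ =
      vecElt θ ![u 0, u 0 + 5 * u 1 + 18 * u 2, 3 * u 1 + 11 * u 2] := by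
  rw [stableLetter, vecElt, inr_one_mul_inl_mul_inv, glMulAut_apply_of_eq hθ, vecElt]

lemma secondGen_vecElt
    (hθ : (θ : Matrix (Fin 3) (Fin 3) ℤ) = !![1, 0, 0; 1, 5, 18; 0, 3, 11]) :
    secondGen (vecElt θ ![1, 0, 0]) (stableLetter θ) = vecElt θ ![0, 1, 0] := by
  rw [secondGen, stableLetter_conj_vecElt hθ, vecElt_inv, vecElt_mul]
  simp

lemma relatorWords_vecElt
    (hθ : (θ : Matrix (Fin 3) (Fin 3) ℤ) = !![1, 0, 0; 1, 5, 18; 0, 3, 11]) (j : Fin 4) :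
    relatorWords (vecElt θ ![1, 0, 0]) (vecElt θ ![0, 0, 1]) (stableLetter θ) j = 1 := by
  rw [relatorWords, secondGen_vecElt hθ]
  fin_cases j <;>
    simp [commutatorElement_def, stableLetter_conj_vecElt hθ, vecElt_inv, vecElt_mul, vecElt_pow]
  all_goals exact (congrArg (vecElt θ) (by simp)).trans vecElt_zero

/-- Three commuting elements and a fourth one conjugating them as prescribed by `θ` define a
homomorphism on `ℤ³ ⋊_θ ℤ`. -/
lemma exists_hom_of_commute
    (hθ : (θ : Matrix (Fin 3) (Fin 3) ℤ) = !![1, 0, 0; 1, 5, 18; 0, 3, 11])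
    {P : Type*} [Group P] {x y z t : P} (hxy : Commute x y) (hxz : Commute x z)
    (hyz : Commute y z) (hx : t * x * t⁻¹ = x * y) (hy : t * y * t⁻¹ = y ^ 5 * z ^ 3)
    (hz : t * z * t⁻¹ = y ^ 18 * z ^ 11) :
    ∃ f : glSemidirect θ →* P, f (vecElt θ ![1, 0, 0]) = x ∧ f (vecElt θ ![0, 0, 1]) = z ∧
      f (stableLetter θ) = t := by
  let f₁ : Multiplicative (Fin 3 → ℤ) →* P := MonoidHom.mk'
    (fun u => x ^ (u.toAdd 0) * y ^ (u.toAdd 1) * z ^ (u.toAdd 2)) fun u v => by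
      simp only [toAdd_mul, Pi.add_apply, zpow_add]
      have a1 := (hxy.zpow_zpow (v.toAdd 0) (u.toAdd 1)).eq
      have a2 := (hxz.zpow_zpow (v.toAdd 0) (u.toAdd 2)).eq
      have a3 := (hyz.zpow_zpow (v.toAdd 1) (u.toAdd 2)).eq
      generalize x ^ (u.toAdd 0) = p at *
      generalize x ^ (v.toAdd 0) = p' at *
      generalize y ^ (u.toAdd 1) = q at *
      generalize y ^ (v.toAdd 1) = q' at *
      generalize z ^ (u.toAdd 2) = r at *
      generalize z ^ (v.toAdd 2) = r' at *
      calc p * p' * (q * q') * (r * r') = p * (p' * q) * (q' * r) * r' := by group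
        _ = p * q * (p' * r) * q' * r' := by rw [a1, a3]; group
        _ = _ := by rw [a2]; group
  have hf₁ (u : Fin 3 → ℤ) :
      f₁ (Multiplicative.ofAdd u) = x ^ (u 0) * y ^ (u 1) * z ^ (u 2) := rfl
  have key (u : Multiplicative (Fin 3 → ℤ)) :
      f₁ (glMulAut θ u) = MulAut.conj t (f₁ u) := by
    obtain ⟨u, rfl⟩ := Multiplicative.ofAdd.surjective u
    rw [glMulAut_apply_of_eq hθ, hf₁, hf₁, map_mul, map_mul, map_zpow, map_zpow, map_zpow,
      MulAut.conj_apply, MulAut.conj_apply, MulAut.conj_apply, hx, hy, hz]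
    rw [hxy.mul_zpow, ((hyz.pow_pow 5 3)).mul_zpow, ((hyz.pow_pow 18 11)).mul_zpow]
    simp only [← zpow_natCast, ← zpow_mul, Matrix.cons_val, zpow_add]
    have := (hyz.zpow_zpow (18 * u 2) (3 * u 1)).eq
    push_cast
    simp only [mul_assoc, Fin.isValue, mul_right_inj]
    rw [← mul_assoc (z ^ (3 * u 1)), ← this, mul_assoc]
  refine ⟨lift f₁ (zpowersHom P t) fun n => ?_, ?_, ?_, ?_⟩
  · refine MonoidHom.ext fun u => ?_
    have := zpowersHom_intertwine f₁ (glMulAut θ) (MulAut.conj t) key n u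
    simp only [MonoidHom.comp_apply, MulEquiv.coe_toMonoidHom, this]
    simp [zpowersHom_apply, map_zpow]
  · rw [vecElt, lift_inl, hf₁]; simp
  · rw [vecElt, lift_inl, hf₁]; simp
  · rw [stableLetter, lift_inr]; simp

lemma closure_generators
    (hθ : (θ : Matrix (Fin 3) (Fin 3) ℤ) = !![1, 0, 0; 1, 5, 18; 0, 3, 11]) :
    Subgroup.closure {vecElt θ ![1, 0, 0], vecElt θ ![0, 0, 1], stableLetter θ} = ⊤ := by
  set K := Subgroup.closure {vecElt θ ![1, 0, 0], vecElt θ ![0, 0, 1], stableLetter θ}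
  have hx : vecElt θ ![1, 0, 0] ∈ K := Subgroup.subset_closure (by simp)
  have hz : vecElt θ ![0, 0, 1] ∈ K := Subgroup.subset_closure (by simp)
  have ht : stableLetter θ ∈ K := Subgroup.subset_closure (by simp)
  have hy : vecElt θ ![0, 1, 0] ∈ K := by
    rw [← secondGen_vecElt hθ]
    exact K.mul_mem (K.inv_mem hx) (K.mul_mem (K.mul_mem ht hx) (K.inv_mem ht))
  refine (Subgroup.eq_top_iff' K).2 fun g => ?_
  rw [← inl_left_mul_inr_right g]
  refine K.mul_mem ?_ ?_
  · have : (inl g.left : glSemidirect θ) = vecElt θ ![1, 0, 0] ^ (g.left.toAdd 0) *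
        vecElt θ ![0, 1, 0] ^ (g.left.toAdd 1) * vecElt θ ![0, 0, 1] ^ (g.left.toAdd 2) := by
      simp only [vecElt, ← map_zpow, ← map_mul, ← ofAdd_zsmul, ← ofAdd_add]
      congr 1
      refine Multiplicative.toAdd.injective (funext fun i => ?_)
      fin_cases i <;> simp
    rw [this]
    exact K.mul_mem (K.mul_mem (K.zpow_mem hx _) (K.zpow_mem hy _)) (K.zpow_mem hz _)
  · have : (inr g.right : glSemidirect θ) = stableLetter θ ^ g.right.toAdd := by
      rw [stableLetter, ← map_zpow, ← ofAdd_zsmul]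
      simp
    rw [this]
    exact K.zpow_mem ht _

lemma hom_ext_generators
    (hθ : (θ : Matrix (Fin 3) (Fin 3) ℤ) = !![1, 0, 0; 1, 5, 18; 0, 3, 11])
    {P : Type*} [Group P] {f g : glSemidirect θ →* P}
    (hx : f (vecElt θ ![1, 0, 0]) = g (vecElt θ ![1, 0, 0]))
    (hz : f (vecElt θ ![0, 0, 1]) = g (vecElt θ ![0, 0, 1]))
    (ht : f (stableLetter θ) = g (stableLetter θ)) : f = g := by
  refine MonoidHom.eq_of_eqOn_dense (closure_generators hθ) ?_
  rintro _ (rfl | rfl | rfl) <;> assumption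

lemma hasPresentation_three_four
    (hθ : (θ : Matrix (Fin 3) (Fin 3) ℤ) = !![1, 0, 0; 1, 5, 18; 0, 3, 11]) :
    HasPresentation (glSemidirect θ) 3 4 := by
  let rels : Fin 4 → FreeGroup (Fin 3) :=
    relatorWords (FreeGroup.of 0) (FreeGroup.of 1) (FreeGroup.of 2)
  let R := Subgroup.normalClosure (Set.range rels)
  let π : FreeGroup (Fin 3) →* FreeGroup (Fin 3) ⧸ R := QuotientGroup.mk' R
  let p : FreeGroup (Fin 3) →* glSemidirect θ :=
    FreeGroup.lift ![vecElt θ ![1, 0, 0], vecElt θ ![0, 0, 1], stableLetter θ]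
  have hp : R ≤ p.ker := by
    refine Subgroup.normalClosure_le_normal ?_
    rintro _ ⟨j, rfl⟩
    change p (rels j) = 1
    simp only [rels, map_relatorWords]
    simpa [p] using relatorWords_vecElt hθ j
  have hπ (j : Fin 4) :
      relatorWords (π (FreeGroup.of 0)) (π (FreeGroup.of 1)) (π (FreeGroup.of 2)) j = 1 := by
    rw [← map_relatorWords]
    exact (QuotientGroup.eq_one_iff _).2 (Subgroup.subset_normalClosure ⟨j, rfl⟩)
  obtain ⟨hxy, hxz, hyz, hx, hy, hz⟩ := commute_of_relatorWords hπ
  obtain ⟨f, fx, fz, ft⟩ := exists_hom_of_commute hθ hxy hxz hyz hx hy hz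
  refine ⟨rels, ⟨MonoidHom.toMulEquiv f (QuotientGroup.lift R p hp) ?_ ?_⟩⟩
  · refine hom_ext_generators hθ ?_ ?_ ?_
    · simp only [MonoidHom.comp_apply, fx]; exact QuotientGroup.lift_mk' .. |>.trans (by simp [p])
    · simp only [MonoidHom.comp_apply, fz]; exact QuotientGroup.lift_mk' .. |>.trans (by simp [p])
    · simp only [MonoidHom.comp_apply, ft]; exact QuotientGroup.lift_mk' .. |>.trans (by simp [p])
  · refine QuotientGroup.monoidHom_ext _ (FreeGroup.ext_hom _ _ fun i => ?_)
    fin_cases i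
    · exact (congrArg f (by simp [p])).trans fx
    · exact (congrArg f (by simp [p])).trans fz
    · exact (congrArg f (by simp [p])).trans ft

lemma abelianization_equiv
    (hθ : (θ : Matrix (Fin 3) (Fin 3) ℤ) = !![1, 0, 0; 1, 5, 18; 0, 3, 11]) :
    Nonempty (Abelianization (glSemidirect θ) ≃* Multiplicative (Fin 2 → ℤ)) := by
  let e (v : Fin 2 → ℤ) : Multiplicative (Fin 2 → ℤ) := Multiplicative.ofAdd v
  obtain ⟨f, fx, fz, ft⟩ := exists_hom_of_commute hθ (x := e ![1, 0]) (y := 1) (z := 1)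
    (t := e ![0, 1]) (Commute.all _ _) (Commute.all _ _) (Commute.all _ _)
    (by simp) (by simp) (by simp)
  let q : glSemidirect θ →* Abelianization (glSemidirect θ) := Abelianization.of
  have hq (j : Fin 4) : relatorWords (q (vecElt θ ![1, 0, 0])) (q (vecElt θ ![0, 0, 1]))
      (q (stableLetter θ)) j = 1 := by
    rw [← map_relatorWords, relatorWords_vecElt hθ, map_one]
  obtain ⟨-, -, -, -, -, hz⟩ := commute_of_relatorWords hq
  have hy : secondGen (q (vecElt θ ![1, 0, 0])) (q (stableLetter θ)) = 1 := by
    simp [secondGen]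
  have hy' := (commute_of_relatorWords hq).2.2.2.2.1
  rw [hy] at hz hy'
  have hz1 : q (vecElt θ ![0, 0, 1]) = 1 := by
    set z := q (vecElt θ ![0, 0, 1])
    have h3 : z ^ 3 = 1 := by simpa using hy'.symm
    have h11 : z = z ^ 11 := by simpa using hz
    have h10 : z ^ 10 = 1 := by
      have : z * 1 = z * z ^ 10 := by rw [← pow_succ', mul_one]; exact h11
      exact (mul_left_cancel this).symm
    calc z = z ^ 10 * ((z ^ 3) ^ 3)⁻¹ := by group
      _ = 1 := by rw [h3, h10]; simp
  let h : Multiplicative (Fin 2 → ℤ) →* Abelianization (glSemidirect θ) := MonoidHom.mk'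
    (fun v => q (vecElt θ ![1, 0, 0]) ^ (v.toAdd 0) * q (stableLetter θ) ^ (v.toAdd 1))
    fun v w => by
      simp only [toAdd_mul, Pi.add_apply, zpow_add]
      exact mul_mul_mul_comm _ _ _ _
  have hh (v : Fin 2 → ℤ) : h (e v) =
    q (vecElt θ ![1, 0, 0]) ^ (v 0) * q (stableLetter θ) ^ (v 1) := rfl
  refine ⟨MonoidHom.toMulEquiv (Abelianization.lift f) h ?_ ?_⟩
  · refine Abelianization.hom_ext _ _ (hom_ext_generators hθ ?_ ?_ ?_)
    · change h (f _) = q _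
      rw [fx, hh]; simp
    · change h (f _) = q _
      rw [fz, map_one, hz1]
    · change h (f _) = q _
      rw [ft, hh]; simp
  · refine MonoidHom.ext fun v => ?_
    obtain ⟨v, rfl⟩ := Multiplicative.ofAdd.surjective v
    change Abelianization.lift f (h (e v)) = e v
    rw [hh, map_mul, map_zpow, map_zpow]
    change f _ ^ _ * f _ ^ _ = _
    rw [fx, ft]
    refine Multiplicative.toAdd.injective (funext fun i => ?_)
    fin_cases i <;> simp [e]

end Example

/-- For `a : Fin 4 → B`, the central extension of `ℤ³` by `B` with cocycle
`(u, v) ↦ u₀ v₁ a₀ + u₀ v₂ a₁`. -/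
@[ext]
structure CentralExt_s14 {B : Type*} (a : Fin 4 → B) where
  /-- The image in `ℤ³`. -/
  vec : Fin 3 → ℤ
  /-- The coordinate in the kernel. -/
  fib : B

namespace CentralExt_s14

variable {B : Type*} [AddCommGroup B] {a : Fin 4 → B}

instance : One (CentralExt_s14 a) := ⟨⟨0, 0⟩⟩

@[simp] lemma one_vec : (1 : CentralExt_s14 a).vec = 0 := rfl

@[simp] lemma one_fib : (1 : CentralExt_s14 a).fib = 0 := rfl

variable [Module (ZMod 3) B]

instance : Mul (CentralExt_s14 a) := ⟨fun k l => ⟨k.vec + l.vec,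
  k.fib + l.fib + ((k.vec 0 * l.vec 1 : ℤ) : ZMod 3) • a 0 +
    ((k.vec 0 * l.vec 2 : ℤ) : ZMod 3) • a 1⟩⟩

instance : Inv (CentralExt_s14 a) := ⟨fun k => ⟨-k.vec,
  -k.fib + ((k.vec 0 * k.vec 1 : ℤ) : ZMod 3) • a 0 +
    ((k.vec 0 * k.vec 2 : ℤ) : ZMod 3) • a 1⟩⟩

@[simp] lemma mul_vec (k l : CentralExt_s14 a) : (k * l).vec = k.vec + l.vec := rfl

@[simp] lemma mul_fib (k l : CentralExt_s14 a) : (k * l).fib =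
  k.fib + l.fib + ((k.vec 0 * l.vec 1 : ℤ) : ZMod 3) • a 0 +
    ((k.vec 0 * l.vec 2 : ℤ) : ZMod 3) • a 1 := rfl

@[simp] lemma inv_vec (k : CentralExt_s14 a) : k⁻¹.vec = -k.vec := rfl

@[simp] lemma inv_fib (k : CentralExt_s14 a) : k⁻¹.fib =
  -k.fib + ((k.vec 0 * k.vec 1 : ℤ) : ZMod 3) • a 0 +
    ((k.vec 0 * k.vec 2 : ℤ) : ZMod 3) • a 1 := rfl

instance : Group (CentralExt_s14 a) :=
  Group.ofLeftAxioms
    (fun k l m => by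
      ext1
      · simp [add_assoc]
      · simp only [mul_fib, mul_vec, Pi.add_apply]
        push_cast
        module)
    (fun k => by ext1 <;> simp)
    (fun k => by
      ext1
      · simp
      · simp only [mul_fib, inv_fib, inv_vec, one_fib, Pi.neg_apply]
        push_cast
        module)

/-- The projection onto `ℤ³`. -/
def toVec : CentralExt_s14 a →* Multiplicative (Fin 3 → ℤ) :=
  MonoidHom.mk' (fun k => Multiplicative.ofAdd k.vec) fun _ _ => rfl

lemma pow_of_vec_zero_eq_zero {k : CentralExt_s14 a} (hk : k.vec 0 = 0) (n : ℕ) :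
    k ^ n = ⟨n • k.vec, (n : ZMod 3) • k.fib⟩ := by
  induction n with
  | zero => ext1 <;> simp
  | succ n ih =>
    rw [pow_succ, ih]
    ext1
    · simp [add_smul]
    · simp [add_smul, hk]

lemma conj_of_vec_eq_zero {l : CentralExt_s14 a} (hl : l.vec = 0) (k : CentralExt_s14 a) :
    k * l * k⁻¹ = l := by
  rw [mul_inv_eq_iff_eq_mul]
  ext1
  · simp [add_comm]
  · simp [hl, add_comm]

variable (a) in
/-- Elements whose coordinate in the kernel lies in a submodule containing the `aᵢ`. -/
def fibSubgroup (S : Submodule (ZMod 3) B) (ha : ∀ j, a j ∈ S) : Subgroup (CentralExt_s14 a) where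
  carrier := {k | k.fib ∈ S}
  mul_mem' hk hl := S.add_mem (S.add_mem (S.add_mem hk hl) (S.smul_mem _ (ha 0)))
    (S.smul_mem _ (ha 1))
  one_mem' := S.zero_mem
  inv_mem' hk := S.add_mem (S.add_mem (S.neg_mem hk) (S.smul_mem _ (ha 0)))
    (S.smul_mem _ (ha 1))

variable (a) in
/-- Elements of the kernel lying in a given submodule. -/
def kerSubgroup (S : Submodule (ZMod 3) B) : Subgroup (CentralExt_s14 a) where
  carrier := {k | k.vec = 0 ∧ k.fib ∈ S}
  mul_mem' {k l} hk hl := ⟨by simp [hk.1, hl.1], by simpa [hk.1] using S.add_mem hk.2 hl.2⟩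
  one_mem' := ⟨rfl, S.zero_mem⟩
  inv_mem' {k} hk := ⟨by simp [hk.1], by simpa [hk.1] using hk.2⟩

variable {θ : GL (Fin 3) ℤ}

variable (a) in
/-- The correction term making `θ` lift to the central extension. -/
def quad (u : Fin 3 → ℤ) : B :=
  ((2 * u 0 ^ 2 : ℤ) : ZMod 3) • a 0 + (u 1 : ZMod 3) • a 2 + (u 2 : ZMod 3) • a 3

variable (a) in
/-- The lift of `θ` to the central extension which acts by `-1` on the kernel. -/
noncomputable def liftAut
    (hθ : (θ : Matrix (Fin 3) (Fin 3) ℤ) = !![1, 0, 0; 1, 5, 18; 0, 3, 11]) :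
    MulAut (CentralExt_s14 a) where
  toFun k := ⟨(Matrix.GeneralLinearGroup.toLin θ).toLinearEquiv k.vec, -k.fib + quad a k.vec⟩
  invFun k := ⟨(Matrix.GeneralLinearGroup.toLin θ).toLinearEquiv.symm k.vec,
    -k.fib + quad a ((Matrix.GeneralLinearGroup.toLin θ).toLinearEquiv.symm k.vec)⟩
  left_inv k := by
    ext1
    · exact LinearEquiv.symm_apply_apply _ _
    · simp only [LinearEquiv.symm_apply_apply]
      abel
  right_inv k := by
    ext1
    · exact LinearEquiv.apply_symm_apply _ _
    · simp
  map_mul' k l := by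
    ext1
    · exact map_add _ _ _
    · simp only [mul_fib, mul_vec, toLin_apply_of_eq hθ, quad, Pi.add_apply, Matrix.cons_val]
      match_scalars <;> ring_nf <;> reduce_mod_char <;> ring

lemma liftAut_vec (hθ : (θ : Matrix (Fin 3) (Fin 3) ℤ) = !![1, 0, 0; 1, 5, 18; 0, 3, 11])
    (k : CentralExt_s14 a) : (liftAut a hθ k).vec =
      ![k.vec 0, k.vec 0 + 5 * k.vec 1 + 18 * k.vec 2, 3 * k.vec 1 + 11 * k.vec 2] :=
  toLin_apply_of_eq hθ k.vec

lemma liftAut_fib (hθ : (θ : Matrix (Fin 3) (Fin 3) ℤ) = !![1, 0, 0; 1, 5, 18; 0, 3, 11])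
    (k : CentralExt_s14 a) : (liftAut a hθ k).fib = -k.fib + quad a k.vec := rfl

lemma quad_mem {S : Submodule (ZMod 3) B} (ha : ∀ j, a j ∈ S) (u : Fin 3 → ℤ) :
    quad a u ∈ S :=
  S.add_mem (S.add_mem (S.smul_mem _ (ha 0)) (S.smul_mem _ (ha 2))) (S.smul_mem _ (ha 3))

lemma liftAut_mem_fibSubgroup_iff
    (hθ : (θ : Matrix (Fin 3) (Fin 3) ℤ) = !![1, 0, 0; 1, 5, 18; 0, 3, 11])
    {S : Submodule (ZMod 3) B} (ha : ∀ j, a j ∈ S) (k : CentralExt_s14 a) :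
    liftAut a hθ k ∈ fibSubgroup a S ha ↔ k ∈ fibSubgroup a S ha := by
  change -k.fib + quad a k.vec ∈ S ↔ k.fib ∈ S
  rw [S.add_mem_iff_left (quad_mem ha _), S.neg_mem_iff]

lemma liftAut_mem_kerSubgroup_iff
    (hθ : (θ : Matrix (Fin 3) (Fin 3) ℤ) = !![1, 0, 0; 1, 5, 18; 0, 3, 11])
    (S : Submodule (ZMod 3) B) (k : CentralExt_s14 a) :
    liftAut a hθ k ∈ kerSubgroup a S ↔ k ∈ kerSubgroup a S := by
  change (Matrix.GeneralLinearGroup.toLin θ).toLinearEquiv k.vec = 0 ∧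
    -k.fib + quad a k.vec ∈ S ↔ k.vec = 0 ∧ k.fib ∈ S
  rw [LinearEquiv.map_eq_zero_iff]
  refine and_congr_right fun h => ?_
  simp [h, quad]

end CentralExt_s14

section TwistedExt

open CentralExt_s14

variable {B : Type*} [AddCommGroup B] [Module (ZMod 3) B] {a : Fin 4 → B} {θ : GL (Fin 3) ℤ}
  (hθ : (θ : Matrix (Fin 3) (Fin 3) ℤ) = !![1, 0, 0; 1, 5, 18; 0, 3, 11])

variable (a) in
/-- The extension of `ℤ³ ⋊_θ ℤ` by `B`, on which `ℤ` acts through the sign character. -/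
abbrev TwistedExt : Type _ :=
  CentralExt_s14 a ⋊[zpowersHom (MulAut (CentralExt_s14 a)) (liftAut a hθ)] Multiplicative ℤ

variable (a) in
/-- The projection of the extension onto `ℤ³ ⋊_θ ℤ`. -/
noncomputable def twistedProj : TwistedExt a hθ →* glSemidirect θ :=
  SemidirectProduct.map toVec (MonoidHom.id _) fun n => MonoidHom.ext
    (zpowersHom_intertwine toVec (liftAut a hθ) (glMulAut θ) (fun _ => rfl) n)

lemma twistedProj_mk (k : CentralExt_s14 a) (n : Multiplicative ℤ) :
    twistedProj a hθ ⟨k, n⟩ = ⟨Multiplicative.ofAdd k.vec, n⟩ := rfl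

variable (a) in
/-- Elements of the extension whose coordinate in `B` lies in a submodule containing the `aᵢ`. -/
noncomputable def twistedFibSubgroup (S : Submodule (ZMod 3) B) (ha : ∀ j, a j ∈ S) :
    Subgroup (TwistedExt a hθ) where
  carrier := {w | w.left ∈ fibSubgroup a S ha}
  mul_mem' hv hw := mul_mem hv ((zpowersHom_apply_mem_iff _ _
    (liftAut_mem_fibSubgroup_iff hθ ha) _ _).2 hw)
  one_mem' := one_mem (fibSubgroup a S ha)
  inv_mem' hw := (zpowersHom_apply_mem_iff _ _
    (liftAut_mem_fibSubgroup_iff hθ ha) _ _).2 (inv_mem hw)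

variable (a) in
/-- A submodule of `B`, as a subgroup of the extension. -/
noncomputable def twistedKerSubgroup (S : Submodule (ZMod 3) B) : Subgroup (TwistedExt a hθ) :=
  (kerSubgroup a S).map inl

lemma twistedKerSubgroup_normal (S : Submodule (ZMod 3) B) :
    (twistedKerSubgroup a hθ S).Normal := by
  refine ⟨?_⟩
  rintro _ ⟨k, hk, rfl⟩ w
  refine ⟨zpowersHom _ (liftAut a hθ) w.right k, (zpowersHom_apply_mem_iff _ _
    (liftAut_mem_kerSubgroup_iff hθ S) _ _).2 hk, ?_⟩
  have h : (zpowersHom _ (liftAut a hθ) w.right k).vec = 0 :=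
    ((zpowersHom_apply_mem_iff _ _ (liftAut_mem_kerSubgroup_iff hθ S) _ _).2 hk).1
  conv_rhs => rw [← inl_left_mul_inr_right w]
  calc inl (zpowersHom _ (liftAut a hθ) w.right k)
      = inl (w.left * zpowersHom _ (liftAut a hθ) w.right k * w.left⁻¹) := by
        rw [conj_of_vec_eq_zero h]
    _ = _ := by rw [map_mul, map_mul, inl_aut, mul_inv_rev, map_inv, map_inv]; group

/-- The values of the four relators on any lifts of the generators are the `aᵢ`. -/
lemma relatorWords_lift {X Z T : TwistedExt a hθ}
    (hX : twistedProj a hθ X = vecElt θ ![1, 0, 0])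
    (hZ : twistedProj a hθ Z = vecElt θ ![0, 0, 1])
    (hT : twistedProj a hθ T = stableLetter θ) (j : Fin 4) :
    relatorWords X Z T j = inl ⟨0, a j⟩ := by
  obtain ⟨b, rfl⟩ : ∃ b, X = inl ⟨![1, 0, 0], b⟩ :=
    ⟨X.left.fib, SemidirectProduct.ext (CentralExt_s14.ext (congrArg (·.left.toAdd) hX) rfl)
      (congrArg (·.right) hX)⟩
  obtain ⟨c, rfl⟩ : ∃ c, Z = inl ⟨![0, 0, 1], c⟩ :=
    ⟨Z.left.fib, SemidirectProduct.ext (CentralExt_s14.ext (congrArg (·.left.toAdd) hZ) rfl)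
      (congrArg (·.right) hZ)⟩
  obtain ⟨d, rfl⟩ : ∃ d, T = inl ⟨0, d⟩ * inr (Multiplicative.ofAdd 1) :=
    ⟨T.left.fib, by
      rw [← mk_eq_inl_mul_inr]
      exact SemidirectProduct.ext (CentralExt_s14.ext (congrArg (·.left.toAdd) hT) rfl)
        (congrArg (·.right) hT)⟩
  have central (k : CentralExt_s14 a) : (⟨0, d⟩ : CentralExt_s14 a) * k * ⟨0, d⟩⁻¹ = k := by
    rw [mul_inv_eq_iff_eq_mul]
    ext1
    · simp [add_comm]
    · simp [add_comm]
  have conj (k : CentralExt_s14 a) :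
      (inl ⟨0, d⟩ * inr (Multiplicative.ofAdd 1)) * inl k *
        (inl ⟨0, d⟩ * inr (Multiplicative.ofAdd 1))⁻¹ =
      (inl (liftAut a hθ k) : TwistedExt a hθ) := by
    calc _ = (inl ⟨0, d⟩ * (inr (Multiplicative.ofAdd 1) * inl k *
          (inr (Multiplicative.ofAdd 1))⁻¹) * (inl ⟨0, d⟩)⁻¹ : TwistedExt a hθ) := by group
      _ = inl (⟨0, d⟩ * liftAut a hθ k * ⟨0, d⟩⁻¹) := by
        rw [inr_one_mul_inl_mul_inv, map_mul, map_mul, map_inv]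
      _ = _ := by rw [central]
  have hY : secondGen (inl ⟨![1, 0, 0], b⟩)
      (inl ⟨0, d⟩ * inr (Multiplicative.ofAdd 1) : TwistedExt a hθ) =
      inl ⟨![0, 1, 0], b + a 0⟩ := by
    rw [secondGen, conj, ← map_inv, ← map_mul]
    congr 1
    ext1
    · simp [liftAut_vec]
    · simp only [mul_fib, inv_fib, inv_vec, liftAut_fib, liftAut_vec, quad, Matrix.cons_val,
        Pi.neg_apply]
      match_scalars <;> ring_nf
      reduce_mod_char
  rw [relatorWords, hY]
  fin_cases j
  · change _ * _ * _⁻¹ * _⁻¹ = _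
    simp only [← map_mul, ← map_inv]
    congr 1
    ext1
    · simp
    · simp; abel
  · change _ * _ * _⁻¹ * _⁻¹ = _
    simp only [← map_mul, ← map_inv]
    congr 1
    ext1
    · simp
    · simp; abel
  · change _ * _ * _⁻¹ * (_ * _)⁻¹ = inl (⟨0, a 2⟩ : CentralExt_s14 a)
    simp only [conj]
    simp only [← map_mul, ← map_inv, ← map_pow]
    congr 1
    rw [mul_inv_eq_iff_eq_mul, pow_of_vec_zero_eq_zero rfl, pow_of_vec_zero_eq_zero rfl]
    ext1
    · simp [liftAut_vec]
    · simp only [mul_fib, liftAut_fib, quad, Matrix.cons_val, Pi.zero_apply, Pi.smul_apply]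
      match_scalars <;> ring_nf <;> reduce_mod_char
  · change _ * _ * _⁻¹ * (_ * _)⁻¹ = inl (⟨0, a 3⟩ : CentralExt_s14 a)
    simp only [conj]
    simp only [← map_mul, ← map_inv, ← map_pow]
    congr 1
    rw [mul_inv_eq_iff_eq_mul, pow_of_vec_zero_eq_zero rfl, pow_of_vec_zero_eq_zero rfl]
    ext1
    · simp [liftAut_vec]
    · simp only [mul_fib, liftAut_fib, quad, Matrix.cons_val, Pi.zero_apply, Pi.smul_apply]
      match_scalars <;> ring_nf <;> reduce_mod_char

end TwistedExt

section LowerBound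

variable {θ : GL (Fin 3) ℤ}

/-- A presentation of `ℤ³ ⋊_θ ℤ` needs more relators than generators: comparing it with a
suitable extension of `ℤ³ ⋊_θ ℤ` by an `𝔽₃`-space of dimension `g + 4`, that space is spanned by
the values of the `r` relators and the coordinates of lifts of three generators. -/
lemma lt_of_hasPresentation
    (hθ : (θ : Matrix (Fin 3) (Fin 3) ℤ) = !![1, 0, 0; 1, 5, 18; 0, 3, 11]) {g r : ℕ}
    (h : HasPresentation (glSemidirect θ) g r) : g + 1 ≤ r := by
  obtain ⟨rels, ⟨e⟩⟩ := h
  set R := Subgroup.normalClosure (Set.range rels)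
  let φ : FreeGroup (Fin g) →* glSemidirect θ :=
    e.symm.toMonoidHom.comp (QuotientGroup.mk' R)
  have hφ : Function.Surjective φ := e.symm.surjective.comp (QuotientGroup.mk'_surjective R)
  have hker {w : FreeGroup (Fin g)} : φ w = 1 ↔ w ∈ R := by
    rw [← QuotientGroup.eq_one_iff]
    exact e.symm.map_eq_one_iff
  let B := (Fin 4 ⊕ Fin g) → ZMod 3
  let a : Fin 4 → B := fun j => Pi.single (Sum.inl j) 1
  let ψ : FreeGroup (Fin g) →* TwistedExt a hθ := FreeGroup.lift fun i =>
    ⟨⟨(φ (FreeGroup.of i)).left.toAdd, Pi.single (Sum.inr i) 1⟩, (φ (FreeGroup.of i)).right⟩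
  have hψ (w : FreeGroup (Fin g)) : twistedProj a hθ (ψ w) = φ w := by
    refine DFunLike.congr_fun (f := (twistedProj a hθ).comp ψ) (FreeGroup.ext_hom _ _ fun i => ?_) w
    simp only [ψ, MonoidHom.comp_apply, FreeGroup.lift_apply_of]
    rfl
  obtain ⟨X, hX⟩ := hφ (vecElt θ ![1, 0, 0])
  obtain ⟨Z, hZ⟩ := hφ (vecElt θ ![0, 0, 1])
  obtain ⟨T, hT⟩ := hφ (stableLetter θ)
  let v : Fin r ⊕ Fin 3 → B := fun s => (ψ (Sum.elim rels ![X, Z, T] s)).left.fib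
  let S : Submodule (ZMod 3) B := Submodule.span (ZMod 3) (Set.range v)
  have hv (s) : v s ∈ S := Submodule.subset_span ⟨s, rfl⟩
  have hR {w : FreeGroup (Fin g)} (hw : w ∈ R) : ψ w ∈ twistedKerSubgroup a hθ S := by
    have := twistedKerSubgroup_normal hθ (a := a) S
    refine (Subgroup.normalClosure_le_normal
      (N := (twistedKerSubgroup a hθ S).comap ψ) ?_) hw
    rintro _ ⟨j, rfl⟩
    have h1 : twistedProj a hθ (ψ (rels j)) = 1 := by
      rw [hψ, hker]
      exact Subgroup.subset_normalClosure ⟨j, rfl⟩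
    exact ⟨(ψ (rels j)).left, ⟨congrArg (·.left.toAdd) h1, hv (Sum.inl j)⟩,
      SemidirectProduct.ext rfl (congrArg (·.right) h1).symm⟩
  have ha (j : Fin 4) : a j ∈ S := by
    have h1 : relatorWords X Z T j ∈ R := by
      rw [← hker, map_relatorWords, hX, hZ, hT, relatorWords_vecElt hθ]
    obtain ⟨k, hk, hk'⟩ := hR h1
    rw [map_relatorWords, relatorWords_lift hθ (by rw [hψ, hX]) (by rw [hψ, hZ])
      (by rw [hψ, hT])] at hk'
    rw [inl_injective hk'] at hk
    exact hk.2
  have hall (w : FreeGroup (Fin g)) : ψ w ∈ twistedFibSubgroup a hθ S ha := by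
    let W : Subgroup (FreeGroup (Fin g)) := (twistedFibSubgroup a hθ S ha).comap ψ
    have hRW {n : FreeGroup (Fin g)} (hn : n ∈ R) : n ∈ W := by
      obtain ⟨k, hk, hk'⟩ := hR hn
      change (ψ n).left.fib ∈ S
      rw [← hk']
      exact hk.2
    have hW : W.map φ = ⊤ := by
      rw [eq_top_iff, ← closure_generators hθ, Subgroup.closure_le]
      rintro _ (rfl | rfl | rfl)
      · exact ⟨X, hv (Sum.inr 0), hX⟩
      · exact ⟨Z, hv (Sum.inr 1), hZ⟩
      · exact ⟨T, hv (Sum.inr 2), hT⟩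
    obtain ⟨w', hw', hww'⟩ : φ w ∈ W.map φ := hW ▸ Subgroup.mem_top _
    have : w'⁻¹ * w ∈ R := by rw [← hker, map_mul, map_inv, hww', inv_mul_cancel]
    have := W.mul_mem hw' (hRW this)
    rwa [mul_inv_cancel_left] at this
  have htop : S = ⊤ := by
    rw [eq_top_iff, ← (Pi.basisFun (ZMod 3) (Fin 4 ⊕ Fin g)).span_eq, Submodule.span_le]
    rintro _ ⟨j | i, rfl⟩
    · simpa [a] using ha j
    · have := hall (FreeGroup.of i)
      rw [FreeGroup.lift_apply_of] at this
      simpa using show Pi.single (Sum.inr i) 1 ∈ S from this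
  have hfin : Module.finrank (ZMod 3) S ≤ r + 3 := by
    simpa [Set.finrank] using finrank_range_le_card (R := ZMod 3) v
  rw [htop, finrank_top, Module.finrank_pi] at hfin
  simp only [Fintype.card_sum, Fintype.card_fin] at hfin
  omega

end LowerBound

/-- Let `θ = [[1,0,0],[1,5,18],[0,3,11]] ∈ SL(3,ℤ)` and `π = ℤ³ ⋊_θ ℤ`. Then the
abelianization `π/π'` is isomorphic to `ℤ²`, yet `def π = −1`: `π` has a presentation
of deficiency `−1` and every finite presentation satisfies `g - r ≤ −1`. -/
theorem deficiency_example_beta_two (θ : GL (Fin 3) ℤ)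
    (hθ : (θ : Matrix (Fin 3) (Fin 3) ℤ) = !![1, 0, 0; 1, 5, 18; 0, 3, 11]) :
    Nonempty (Abelianization (glSemidirect θ) ≃* Multiplicative (Fin 2 → ℤ)) ∧
    (∃ g r : ℕ, HasPresentation (glSemidirect θ) g r ∧ (g : ℤ) - (r : ℤ) = -1) ∧
    (∀ g r : ℕ, HasPresentation (glSemidirect θ) g r → (g : ℤ) - (r : ℤ) ≤ -1) := by
  refine ⟨abelianization_equiv hθ, ⟨3, 4, hasPresentation_three_four hθ, by norm_num⟩,
    fun g r h => ?_⟩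
  have := lt_of_hasPresentation hθ h
  omega
end

section
/- Let G be a finitely generated group and let K_G be the set of elements of G that centralize some finite-index normal subgroup of G. Then K_G is a normal subgroup of G, the commutator subgroup K_G′ is locally finite, and K_G is (locally nilpotent)-by-(locally finite): there is a normal subgroup L of K_G which is locally nilpotent such that K_G/L is locally finite. -/
/-- The set of elements of `G` centralizing some finite-index normal subgroup of `G`;
this is the kernel of the natural map from `G` to its abstract commensurator. -/
def KSet (G : Type*) [Group G] : Set G :=
  {g : G | ∃ H : Subgroup G, H.Normal ∧ H.FiniteIndex ∧ ∀ h ∈ H, Commute g h}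

/-- A group is locally finite if every finitely generated subgroup is finite. -/
def LocallyFiniteGroup (G : Type*) [Group G] : Prop :=
  ∀ s : Finset G, Finite (Subgroup.closure (s : Set G))

/-- A group is locally nilpotent if every finitely generated subgroup is nilpotent. -/
def LocallyNilpotentGroup (G : Type*) [Group G] : Prop :=
  ∀ s : Finset G, Group.IsNilpotent (Subgroup.closure (s : Set G))

namespace Subgroup

theorem iSup_commutator_le {G : Type*} [Group G] {ι : Sort*} {A : ι → Subgroup G}
    {B N : Subgroup G} [N.Normal] (h : ∀ i, ⁅A i, B⁆ ≤ N) : ⁅⨆ i, A i, B⁆ ≤ N := by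
  have key (X : Subgroup G) : ⁅X, B⁆ ≤ N ↔
      X.map (QuotientGroup.mk' N) ≤ centralizer (B.map (QuotientGroup.mk' N)) := by
    rw [← commutator_eq_bot_iff_le_centralizer, ← map_commutator, map_eq_bot_iff,
      QuotientGroup.ker_mk']
  rw [key, map_iSup]
  exact iSup_le fun i ↦ (key _).1 (h i)

/-- Fitting's theorem for finitely many abelian normal subgroups. -/
theorem isNilpotent_biSup_of_commutator_eq_bot {G ι : Type*} [Group G] (A : ι → Subgroup G)
    (hA : ∀ i, (A i).Normal) (hab : ∀ i, ⁅A i, A i⁆ = ⊥) (t : Finset ι) :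
    Group.IsNilpotent (⨆ i ∈ t, A i : Subgroup G) := by
  classical
  let D (n : ℕ) : Subgroup G := ⨆ u : {u : Finset ι // u ⊆ t ∧ u.card = n}, ⨅ i ∈ u.1, A i
  have hI (u : Finset ι) : (⨅ i ∈ u, A i).Normal :=
    normal_iInf_normal fun i ↦ normal_iInf_normal fun _ ↦ hA i
  have hD (n : ℕ) : (D n).Normal := by
    have (u : {u : Finset ι // u ⊆ t ∧ u.card = n}) : (⨅ i ∈ u.1, A i).Normal := hI _
    exact iSup_normal _
  have step (n : ℕ) : ⁅D n, ⨆ i ∈ t, A i⁆ ≤ D (n + 1) := by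
    have := hD (n + 1)
    refine iSup_commutator_le fun ⟨u, hut, hu⟩ ↦ ?_
    rw [commutator_comm]
    refine iSup_commutator_le fun i ↦ iSup_commutator_le fun hi ↦ ?_
    have := hI u
    have := hA i
    by_cases hiu : i ∈ u
    · calc ⁅A i, ⨅ j ∈ u, A j⁆ ≤ ⁅A i, A i⁆ := commutator_mono le_rfl (iInf₂_le i hiu)
        _ ≤ D (n + 1) := by simp [hab]
    · refine le_trans ?_ (le_iSup (fun u : {u : Finset ι // u ⊆ t ∧ u.card = n + 1} ↦
        ⨅ i ∈ u.1, A i) ⟨insert i u, Finset.insert_subset hi hut, by simp [hiu, hu]⟩)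
      simpa [Finset.iInf_insert] using
        And.intro (commutator_le_left (A i) (⨅ j ∈ u, A j)) fun j hj ↦
          (commutator_le_right (A i) (⨅ j ∈ u, A j)).trans (iInf₂_le j hj)
  have hle (n : ℕ) : (⨆ i ∈ t, A i : Subgroup G).lowerCentralSeries n ≤ D n := by
    induction n with
    | zero =>
      refine le_top.trans ?_
      refine le_trans ?_ (le_iSup (fun u : {u : Finset ι // u ⊆ t ∧ u.card = 0} ↦
        ⨅ i ∈ u.1, A i) ⟨∅, by simp, by simp⟩)
      simp
    | succ n ih => exact (commutator_mono ih le_rfl).trans (step n)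
  refine isNilpotent_of_lowerCentralSeries_eq_bot (n := t.card + 1) ?_
  refine le_bot_iff.1 ((hle _).trans (iSup_le fun ⟨u, hut, hu⟩ ↦ ?_))
  have := Finset.card_le_card hut
  omega

/-- Schur's theorem: a group with centre of finite index has finite commutator subgroup. -/
theorem finite_commutator_of_finiteIndex_center {G : Type*} [Group G]
    [(center G).FiniteIndex] : Finite (_root_.commutator G) := by
  have : Finite (commutatorSet G) := by
    refine Set.Finite.subset (Set.finite_range
      fun p : (G ⧸ center G) × (G ⧸ center G) ↦ p.1.out * p.2.out * p.1.out⁻¹ * p.2.out⁻¹) ?_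
    rintro _ ⟨x, y, rfl⟩
    obtain ⟨a, ha⟩ := QuotientGroup.mk_out_eq_mul (center G) x
    obtain ⟨b, hb⟩ := QuotientGroup.mk_out_eq_mul (center G) y
    refine ⟨(x, y), ?_⟩
    have h1 := mem_center_iff.1 a.2
    have h2 := mem_center_iff.1 b.2
    simp only [ha, hb, commutatorElement_def, mul_inv_rev]
    calc x * a * (y * b) * ((a : G)⁻¹ * x⁻¹) * ((b : G)⁻¹ * y⁻¹)
        = x * (a * (y * b)) * (a : G)⁻¹ * x⁻¹ * ((b : G)⁻¹ * y⁻¹) := by group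
      _ = x * y * (b * x⁻¹) * (b : G)⁻¹ * y⁻¹ := by rw [← h1]; group
      _ = x * y * x⁻¹ * y⁻¹ := by rw [← h2]; group
  infer_instance

theorem finite_commutator_centralizer {G : Type*} [Group G] (H : Subgroup G) [H.FiniteIndex] :
    Finite (⁅centralizer (H : Set G), centralizer (H : Set G)⁆ : Subgroup G) := by
  have : (center (centralizer (H : Set G))).FiniteIndex := by
    refine finiteIndex_of_le (H := H.subgroupOf (centralizer (H : Set G))) fun x hx ↦ ?_
    exact mem_center_iff.2 fun y ↦ Subtype.ext (mem_centralizer_iff.1 y.2 x hx).symm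
  have := finite_commutator_of_finiteIndex_center (G := centralizer (H : Set G))
  rw [← map_subtype_commutator]
  exact Set.Finite.image _ (Set.toFinite _)

theorem exists_finiteIndex_normal_forall_mem {G : Type*} [Group G] {F : Subgroup G → Subgroup G}
    (hF : Antitone F) (s : Finset G)
    (hs : ∀ x ∈ s, ∃ H : Subgroup G, H.Normal ∧ H.FiniteIndex ∧ x ∈ F H) :
    ∃ H : Subgroup G, H.Normal ∧ H.FiniteIndex ∧ ∀ x ∈ s, x ∈ F H := by
  classical
  induction s using Finset.induction_on with
  | empty => exact ⟨⊤, inferInstance, inferInstance, by simp⟩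
  | insert a s _ ih =>
    obtain ⟨H, _, _, hH⟩ := ih fun x hx ↦ hs x (Finset.mem_insert_of_mem hx)
    obtain ⟨H', _, _, hH'⟩ := hs a (Finset.mem_insert_self a s)
    refine ⟨H ⊓ H', inferInstance, inferInstance, fun x hx ↦ ?_⟩
    rcases Finset.mem_insert.1 hx with rfl | hx
    · exact hF inf_le_right hH'
    · exact hF inf_le_left (hH x hx)

theorem exists_finset_mem_biSup {G ι : Type*} [Group G] {A : ι → Subgroup G} (s : Finset G)
    (hs : ∀ x ∈ s, x ∈ ⨆ i, A i) : ∃ t : Finset ι, ∀ x ∈ s, x ∈ ⨆ i ∈ t, A i := by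
  classical
  induction s using Finset.induction_on with
  | empty => exact ⟨∅, by simp⟩
  | insert a s _ ih =>
    obtain ⟨t, ht⟩ := ih fun x hx ↦ hs x (Finset.mem_insert_of_mem hx)
    have ha := hs a (Finset.mem_insert_self a s)
    rw [iSup_eq_iSup_finset, mem_iSup_of_directed] at ha
    · obtain ⟨u, hu⟩ := ha
      refine ⟨t ∪ u, fun x hx ↦ ?_⟩
      rcases Finset.mem_insert.1 hx with rfl | hx
      · exact (biSup_mono fun i hi ↦ Finset.mem_union_right t hi : ⨆ i ∈ u, A i ≤ _) hu
      · exact (biSup_mono fun i hi ↦ Finset.mem_union_left u hi : ⨆ i ∈ t, A i ≤ _) (ht x hx)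
    · exact Monotone.directed_le fun u v huv ↦ biSup_mono fun i hi ↦ Finset.mem_of_subset huv hi

theorem centralizer_coe_antitone {G : Type*} [Group G] :
    Antitone fun H : Subgroup G ↦ centralizer (H : Set G) :=
  fun _ _ h ↦ centralizer_le h

end Subgroup

section

open Subgroup

theorem mem_KSet_iff {G : Type*} [Group G] {g : G} :
    g ∈ KSet G ↔ ∃ H : Subgroup G, H.Normal ∧ H.FiniteIndex ∧ g ∈ centralizer (H : Set G) := by
  simp only [KSet, Set.mem_ofPred_eq, mem_centralizer_iff]
  exact exists_congr fun H ↦ and_congr_right fun _ ↦ and_congr_right fun _ ↦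
    forall₂_congr fun h _ ↦ eq_comm

/-- `KSet G` as a subgroup. -/
def KSubgroup (G : Type*) [Group G] : Subgroup G where
  carrier := KSet G
  one_mem' := mem_KSet_iff.2 ⟨⊤, inferInstance, inferInstance, one_mem _⟩
  inv_mem' h := by
    obtain ⟨H, hn, hi, h⟩ := mem_KSet_iff.1 h
    exact mem_KSet_iff.2 ⟨H, hn, hi, inv_mem h⟩
  mul_mem' ha hb := by
    obtain ⟨H, _, _, h⟩ := mem_KSet_iff.1 ha
    obtain ⟨H', _, _, h'⟩ := mem_KSet_iff.1 hb
    exact mem_KSet_iff.2 ⟨H ⊓ H', inferInstance, inferInstance,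
      mul_mem (centralizer_coe_antitone inf_le_left h) (centralizer_coe_antitone inf_le_right h')⟩

namespace KSubgroup

variable {G : Type*} [Group G]

theorem mem_iff {g : G} : g ∈ KSubgroup G ↔
    ∃ H : Subgroup G, H.Normal ∧ H.FiniteIndex ∧ g ∈ centralizer (H : Set G) :=
  mem_KSet_iff

instance : (KSubgroup G).Normal where
  conj_mem n hn g := by
    obtain ⟨H, _, hi, h⟩ := mem_iff.1 hn
    exact mem_iff.2 ⟨H, inferInstance, hi, Normal.conj_mem inferInstance n h g⟩

theorem centralizer_le (H : Subgroup G) [hn : H.Normal] [hi : H.FiniteIndex] :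
    centralizer (H : Set G) ≤ KSubgroup G :=
  fun _ hg ↦ mem_iff.2 ⟨H, hn, hi, hg⟩

theorem exists_mem_commutator_centralizer {x : G} (hx : x ∈ ⁅KSubgroup G, KSubgroup G⁆) :
    ∃ H : Subgroup G, H.Normal ∧ H.FiniteIndex ∧
      x ∈ ⁅centralizer (H : Set G), centralizer (H : Set G)⁆ := by
  have mono : Antitone fun H : Subgroup G ↦ ⁅centralizer (H : Set G), centralizer (H : Set G)⁆ :=
    fun _ _ h ↦ commutator_mono (centralizer_coe_antitone h) (centralizer_coe_antitone h)
  induction hx using closure_induction with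
  | one => exact ⟨⊤, inferInstance, inferInstance, one_mem _⟩
  | mem x hx =>
    obtain ⟨a, ha, b, hb, rfl⟩ := hx
    obtain ⟨H, _, _, h⟩ := mem_iff.1 ha
    obtain ⟨H', _, _, h'⟩ := mem_iff.1 hb
    exact ⟨H ⊓ H', inferInstance, inferInstance, commutator_mem_commutator
      (centralizer_coe_antitone inf_le_left h) (centralizer_coe_antitone inf_le_right h')⟩
  | inv x _ h =>
    obtain ⟨H, hn, hi, h⟩ := h
    exact ⟨H, hn, hi, inv_mem h⟩
  | mul x y _ _ h h' =>
    obtain ⟨H, _, _, h⟩ := h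
    obtain ⟨H', _, _, h'⟩ := h'
    exact ⟨H ⊓ H', inferInstance, inferInstance,
      mul_mem (mono inf_le_left h) (mono inf_le_right h')⟩

theorem locallyFiniteGroup_commutator : LocallyFiniteGroup (commutator (KSubgroup G)) := by
  classical
  intro s
  let f : commutator (KSubgroup G) →* G :=
    (KSubgroup G).subtype.comp (commutator (KSubgroup G)).subtype
  have hf : Function.Injective f := Subtype.val_injective.comp Subtype.val_injective
  obtain ⟨H, _, _, h⟩ := exists_finiteIndex_normal_forall_mem
    (F := fun H ↦ ⁅centralizer (H : Set G), centralizer (H : Set G)⁆)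
    (fun _ _ h ↦ commutator_mono (centralizer_coe_antitone h) (centralizer_coe_antitone h))
    (s.image f) (by
      simp only [Finset.mem_image, forall_exists_index, and_imp]
      rintro _ x _ rfl
      refine exists_mem_commutator_centralizer ?_
      rw [← map_subtype_commutator]
      exact mem_map_of_mem _ x.2)
  have := finite_commutator_centralizer H
  have hle : closure (s : Set (commutator (KSubgroup G))) ≤
      comap f ⁅centralizer (H : Set G), centralizer (H : Set G)⁆ :=
    (closure_le _).2 fun x hx ↦ h _ (Finset.mem_image_of_mem f hx)
  have hfin : Set.Finite ((⁅centralizer (H : Set G), centralizer (H : Set G)⁆ : Subgroup G) :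
      Set G) :=
    Set.toFinite _
  exact (hfin.preimage hf.injOn).subset hle

/-- The join of the centres of all normal subgroups of finite index. -/
def centerJoin (G : Type*) [Group G] : Subgroup G :=
  ⨆ H : {H : Subgroup G // H.Normal ∧ H.FiniteIndex}, H.1 ⊓ centralizer (H.1 : Set G)

instance (H : {H : Subgroup G // H.Normal ∧ H.FiniteIndex}) :
    (H.1 ⊓ centralizer (H.1 : Set G)).Normal := by
  have := H.2.1
  infer_instance

instance : (centerJoin G).Normal := iSup_normal _

theorem locallyNilpotentGroup_centerJoin :
    LocallyNilpotentGroup ((centerJoin G).subgroupOf (KSubgroup G)) := by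
  classical
  intro s
  let f : (centerJoin G).subgroupOf (KSubgroup G) →* G :=
    (KSubgroup G).subtype.comp ((centerJoin G).subgroupOf (KSubgroup G)).subtype
  have hf : Function.Injective f := Subtype.val_injective.comp Subtype.val_injective
  obtain ⟨t, ht⟩ := exists_finset_mem_biSup
    (A := fun H : {H : Subgroup G // H.Normal ∧ H.FiniteIndex} ↦
      H.1 ⊓ centralizer (H.1 : Set G)) (s.image f) (by
      simp only [Finset.mem_image, forall_exists_index, and_imp]
      rintro _ x _ rfl
      exact x.2)
  have hnil := isNilpotent_biSup_of_commutator_eq_bot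
    (fun H : {H : Subgroup G // H.Normal ∧ H.FiniteIndex} ↦ H.1 ⊓ centralizer (H.1 : Set G))
    (fun _ ↦ inferInstance)
    (fun _ ↦ commutator_eq_bot_iff_le_centralizer.2
      (inf_le_right.trans (centralizer_coe_antitone inf_le_left))) t
  have hle : closure (s : Set ((centerJoin G).subgroupOf (KSubgroup G))) ≤ comap f
      (⨆ H ∈ t, H.1 ⊓ centralizer (H.1 : Set G)) :=
    (closure_le _).2 fun x hx ↦ ht _ (Finset.mem_image_of_mem f hx)
  let g := (f.comp (Subgroup.closure
      (s : Set ((centerJoin G).subgroupOf (KSubgroup G)))).subtype).codRestrict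
    (⨆ H ∈ t, H.1 ⊓ centralizer (H.1 : Set G)) fun x ↦ hle x.2
  have hg : Function.Injective g := fun x y hxy ↦
    Subtype.ext (hf (by simpa [g, MonoidHom.codRestrict] using hxy))
  exact Subgroup.isNilpotent_of_ker_le_center g (((MonoidHom.ker_eq_bot_iff g).2 hg).trans_le bot_le)

theorem locallyFiniteGroup_quotient_centerJoin :
    LocallyFiniteGroup (KSubgroup G ⧸ (centerJoin G).subgroupOf (KSubgroup G)) := by
  classical
  intro s
  obtain ⟨H, hn, hi, h⟩ := exists_finiteIndex_normal_forall_mem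
    (F := fun H ↦ centralizer (H : Set G)) centralizer_coe_antitone
    (s.image fun q ↦ (q.out : G)) (by
      simp only [Finset.mem_image, forall_exists_index, and_imp]
      rintro _ x _ rfl
      exact mem_iff.1 x.out.2)
  let f : centralizer (H : Set G) →* KSubgroup G ⧸ (centerJoin G).subgroupOf (KSubgroup G) :=
    (QuotientGroup.mk' _).comp (inclusion (centralizer_le H))
  have hker : f.ker.FiniteIndex := by
    refine finiteIndex_of_le (H := H.subgroupOf (centralizer (H : Set G))) fun x hx ↦ ?_
    refine (QuotientGroup.eq_one_iff _).2 ?_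
    exact le_iSup (fun H : {H : Subgroup G // H.Normal ∧ H.FiniteIndex} ↦
      H.1 ⊓ centralizer (H.1 : Set G)) ⟨H, hn, hi⟩ ⟨hx, x.2⟩
  have : Finite f.range := Finite.of_equiv _ (QuotientGroup.quotientKerEquivRange f).toEquiv
  have hle : closure (s : Set (KSubgroup G ⧸ (centerJoin G).subgroupOf (KSubgroup G))) ≤
      f.range := (closure_le _).2 fun q hq ↦
    ⟨⟨q.out, h _ (Finset.mem_image_of_mem _ hq)⟩, QuotientGroup.out_eq' q⟩
  exact Finite.of_injective _ (inclusion_injective hle)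

end KSubgroup

end

/-- For a finitely generated group `G`, the set `K_G` of elements centralizing some
finite-index normal subgroup is a normal subgroup, its commutator subgroup `K_G′` is
locally finite, and `K_G` is (locally nilpotent)-by-(locally finite): there is a
locally nilpotent normal subgroup `L` of `K_G` with `K_G/L` locally finite. -/
theorem KG_locally_nilpotent_by_locally_finite (G : Type*) [Group G] (hfg : Group.FG G) :
    ∃ K : Subgroup G, (K : Set G) = KSet G ∧ K.Normal ∧
      LocallyFiniteGroup (commutator K) ∧
      ∃ L : Subgroup K, ∃ _ : L.Normal,
        LocallyNilpotentGroup L ∧ LocallyFiniteGroup (K ⧸ L) := by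
  exact ⟨KSubgroup G, rfl, inferInstance, KSubgroup.locallyFiniteGroup_commutator,
    (KSubgroup.centerJoin G).subgroupOf (KSubgroup G), inferInstance,
    KSubgroup.locallyNilpotentGroup_centerJoin, KSubgroup.locallyFiniteGroup_quotient_centerJoin⟩
end

section
/- Let G be a finitely generated group such that the centralizer C_G(H) is finite for every finite-index normal subgroup H of G. Then: (i) the subgroup K_G consisting of all elements of G that centralize some finite-index normal subgroup of G is locally finite; and (ii) the subgroup K_aut(G) of Aut(G) consisting of all automorphisms of G that restrict to the identity on some finite-index subgroup of G is locally finite. -/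
/-- The set of automorphisms of `G` restricting to the identity on some
finite-index subgroup of `G`. -/
def KAutSet (G : Type*) [Group G] : Set (MulAut G) :=
  {φ : MulAut G | ∃ H : Subgroup G, H.FiniteIndex ∧ ∀ h ∈ H, φ h = h}

/-- A subgroup-valued antitone function of the finite-index subgroups of `G`, with finite values
on the normal ones, has a locally finite subgroup as its union. -/
theorem exists_locallyFinite_union {G Γ : Type*} [Group G] [Group Γ]
    (F : Subgroup G → Subgroup Γ) (hF : Antitone F)
    (hfin : ∀ H : Subgroup G, H.Normal → H.FiniteIndex → Finite (F H)) :
    ∃ K : Subgroup Γ, (K : Set Γ) = {x | ∃ H : Subgroup G, H.FiniteIndex ∧ x ∈ F H} ∧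
      LocallyFiniteGroup K := by
  let K : Subgroup Γ :=
    { carrier := {x | ∃ H : Subgroup G, H.FiniteIndex ∧ x ∈ F H}
      one_mem' := ⟨⊤, inferInstance, one_mem _⟩
      mul_mem' := by
        rintro x y ⟨H, hH, hx⟩ ⟨L, hL, hy⟩
        exact ⟨H ⊓ L, inferInstance, mul_mem (hF inf_le_left hx) (hF inf_le_right hy)⟩
      inv_mem' := by
        rintro x ⟨H, hH, hx⟩
        exact ⟨H, hH, inv_mem hx⟩ }
  refine ⟨K, rfl, fun s => ?_⟩
  choose H hH hmem using fun x : K => x.2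
  let L : Subgroup G := (⨅ x : s, H x).normalCore
  have hI : (⨅ x : s, H x).FiniteIndex := Subgroup.finiteIndex_iInf fun x => hH x
  have hL : Finite (F L) := hfin L inferInstance inferInstance
  have hle : Subgroup.closure (s : Set K) ≤ (F L).comap K.subtype := by
    rw [Subgroup.closure_le]
    intro x hx
    exact hF ((Subgroup.normalCore_le _).trans (iInf_le _ (⟨x, hx⟩ : s))) (hmem x)
  refine Finite.of_injective
    (fun x : Subgroup.closure (s : Set K) => (⟨x, hle x.2⟩ : F L)) fun x y h => ?_
  exact Subtype.ext (Subtype.ext (congrArg (F L).subtype h))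

/-- In a finitely generated group, only finitely many automorphisms fix pointwise a given normal
subgroup with finite centralizer. -/
theorem finite_fixingSubgroup_mulAut {G : Type*} [Group G] (hfg : Group.FG G)
    (N : Subgroup G) [N.Normal] [Finite (Subgroup.centralizer (N : Set G))] :
    Finite (fixingSubgroup (MulAut G) (N : Set G)) := by
  obtain ⟨S, hS⟩ := Group.fg_def.mp hfg
  have fix (φ : fixingSubgroup (MulAut G) (N : Set G)) (n : G) (hn : n ∈ N) : φ.1 n = n :=
    (mem_fixingSubgroup_iff _).mp φ.2 n hn
  have key (φ : fixingSubgroup (MulAut G) (N : Set G)) (g : G) :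
      g⁻¹ * φ.1 g ∈ Subgroup.centralizer (N : Set G) := by
    rw [Subgroup.mem_centralizer_iff]
    intro n hn
    have h := fix φ _ (‹N.Normal›.conj_mem n hn g)
    rw [map_mul, map_mul, map_inv, fix φ n hn, mul_inv_eq_iff_eq_mul] at h
    rw [mul_assoc, h]
    group
  refine Finite.of_injective
    (fun φ (g : S) => (⟨_, key φ g⟩ : Subgroup.centralizer (N : Set G))) fun φ ψ h => ?_
  refine Subtype.ext (MulEquiv.toMonoidHom_injective (MonoidHom.eq_of_eqOn_dense hS ?_))
  intro g hg
  exact mul_left_cancel (congrArg Subtype.val (congrFun h ⟨g, hg⟩))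


/-- If `G` is finitely generated and the centralizer of every finite-index normal
subgroup of `G` is finite, then (i) `K_G` is locally finite, and (ii) the subgroup
`K_aut(G)` of `Aut G` of automorphisms fixing some finite-index subgroup pointwise
is locally finite. -/
theorem KG_and_KAut_locally_finite (G : Type*) [Group G] (hfg : Group.FG G)
    (hcent : ∀ H : Subgroup G, H.Normal → H.FiniteIndex →
      Finite (Subgroup.centralizer (H : Set G))) :
    (∃ K : Subgroup G, (K : Set G) = KSet G ∧ LocallyFiniteGroup K) ∧
    (∃ KA : Subgroup (MulAut G), (KA : Set (MulAut G)) = KAutSet G ∧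
      LocallyFiniteGroup KA) := by
  constructor
  · have hset : KSet G =
        {x | ∃ H : Subgroup G, H.FiniteIndex ∧ x ∈ Subgroup.centralizer (H : Set G)} := by
      ext g
      constructor
      · rintro ⟨H, -, hH, h⟩
        exact ⟨H, hH, Subgroup.mem_centralizer_iff.mpr fun n hn => (h n hn).symm⟩
      · rintro ⟨H, hH, h⟩
        exact ⟨H.normalCore, inferInstance, inferInstance, fun n hn =>
          (Subgroup.mem_centralizer_iff.mp h n (H.normalCore_le hn)).symm⟩
    rw [hset]
    exact exists_locallyFinite_union (fun H : Subgroup G => Subgroup.centralizer (H : Set G))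
      (fun _ _ h => Subgroup.centralizer_le h) hcent
  · have hset : KAutSet G =
        {φ | ∃ H : Subgroup G, H.FiniteIndex ∧ φ ∈ fixingSubgroup (MulAut G) (H : Set G)} := by
      ext φ
      simp [KAutSet, mem_fixingSubgroup_iff]
    rw [hset]
    exact exists_locallyFinite_union
      (fun H : Subgroup G => fixingSubgroup (MulAut G) (H : Set G))
      (fun _ _ h => fixingSubgroup_antitone _ _ h)
      fun H hH hHf => have := hcent H hH hHf; finite_fixingSubgroup_mulAut hfg H
end
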